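/- arXiv:1802.10337 — 7 statements merged into one kernel-verified Lean document; each statement's English description precedes it below -/
import Mathlib

section
/- Let K be a field, n ∈ ℕ, and let Q_1, ..., Q_k be elements of gl_∞ over K. Define rk(Q_1,...,Q_k) as the infimum over (μ_1 : ... : μ_k) ∈ ℙ^{k-1} of rk(μ_1 Q_1 + ... + μ_k Q_k). Then rk(Q_1,...,Q_k) equals sup over n ∈ ℕ of rk(pr_n(Q_1), ..., pr_n(Q_k)), where pr_n denotes projection onto the top-left n×n submatrix. -/
open scoped ENat

/-- The top-left `n × n` corner of an `ℕ × ℕ` matrix (an element of `gl_∞`). -/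
noncomputable def glInfCorner {K : Type*} [Field K] (n : ℕ) (P : ℕ → ℕ → K) :
    Matrix (Fin n) (Fin n) K :=
  Matrix.of fun i j => P (i : ℕ) (j : ℕ)

/-- The rank of an element of `gl_∞`: the supremum of the ranks of its finite corners. -/
noncomputable def glInfRank {K : Type*} [Field K] (P : ℕ → ℕ → K) : ℕ∞ :=
  ⨆ n : ℕ, ((glInfCorner n P).rank : ℕ∞)

/-- The rank of a tuple of `n × n` matrices: the infimum over the projective space of
nonzero coefficient tuples of the rank of the corresponding linear combination. -/
noncomputable def tupleRankFin {K : Type*} [Field K] {n k : ℕ}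
    (Q : Fin k → Matrix (Fin n) (Fin n) K) : ℕ∞ :=
  ⨅ μ : {μ : Fin k → K // μ ≠ 0}, ((∑ t, μ.1 t • Q t).rank : ℕ∞)

/-- The rank of a tuple of elements of `gl_∞`. -/
noncomputable def tupleRankInf {K : Type*} [Field K] {k : ℕ}
    (Q : Fin k → ℕ → ℕ → K) : ℕ∞ :=
  ⨅ μ : {μ : Fin k → K // μ ≠ 0}, glInfRank (fun i j => ∑ t, μ.1 t * Q t i j)

theorem aux_rows {K : Type*} [Field K] {m n : Type*} [Fintype m] [Fintype n]
    (A : Matrix m n K) (s : ℕ) (hs : s ≤ A.rank) :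
    ∃ f : Fin s → m, LinearIndependent K (A.submatrix f id).row := by
  obtain ⟨κ, a, ha, hsp, hli⟩ := exists_linearIndependent' K A.row
  have : Finite κ := Finite.of_injective a ha
  have := Fintype.ofFinite κ
  have hc : s ≤ Fintype.card κ := by
    rw [← finrank_span_eq_card hli, hsp, ← Matrix.rank_eq_finrank_span_row]
    exact hs
  obtain ⟨e⟩ := Function.Embedding.nonempty_of_card_le (α := Fin s) (β := κ) (by simpa using hc)
  exact ⟨a ∘ e, hli.comp e e.injective⟩

theorem aux_minor {K : Type*} [Field K] {m n : Type*} [Fintype m] [Fintype n]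
    (A : Matrix m n K) (s : ℕ) (hs : s ≤ A.rank) :
    ∃ (f : Fin s → m) (g : Fin s → n), (A.submatrix f g).det ≠ 0 := by
  obtain ⟨f, hf⟩ := aux_rows A s hs
  have h1 := hf.rank_matrix
  rw [← Matrix.rank_transpose, Fintype.card_fin] at h1
  obtain ⟨g, hg⟩ := aux_rows _ s h1.ge
  refine ⟨f, g, ?_⟩
  have h2 := Matrix.linearIndependent_rows_iff_isUnit.mp hg
  rw [Matrix.isUnit_iff_isUnit_det, ← Matrix.det_transpose] at h2
  exact h2.ne_zero

theorem aux_minor_zero {K : Type*} [Field K] {m n : Type*} [Fintype m] [Fintype n]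
    (A : Matrix m n K) (s : ℕ) (hs : A.rank < s) (f : Fin s → m) (g : Fin s → n) :
    (A.submatrix f g).det = 0 := by
  by_contra h
  have h1 := Matrix.rank_of_det_ne_zero h
  have h2 := Matrix.rank_submatrix_le A f g
  rw [h1, Fintype.card_fin] at h2
  omega

/-- The generic linear combination of the `Q t`. -/
noncomputable def genMinor {K : Type*} [Field K] {k : ℕ} (Q : Fin k → ℕ → ℕ → K) (s : ℕ)
    (f g : Fin s → ℕ) : MvPolynomial (Fin k) K :=
  (Matrix.of fun i j => ∑ t, MvPolynomial.X t * MvPolynomial.C (Q t (f i) (g j))).det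

theorem eval_genMinor {K : Type*} [Field K] {k : ℕ} (Q : Fin k → ℕ → ℕ → K) (s : ℕ)
    (f g : Fin s → ℕ) (μ : Fin k → K) :
    MvPolynomial.eval μ (genMinor Q s f g) =
      (Matrix.of fun i j => ∑ t, μ t * Q t (f i) (g j)).det := by
  rw [genMinor, RingHom.map_det]
  congr 1
  ext i j
  simp

theorem corner_sum {K : Type*} [Field K] {k : ℕ} (Q : Fin k → ℕ → ℕ → K) (n : ℕ)
    (μ : Fin k → K) :
    ∑ t, μ t • glInfCorner n (Q t) = glInfCorner n (fun i j => ∑ t, μ t * Q t i j) := by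
  ext i j
  simp [glInfCorner, Matrix.sum_apply]

/-- The tuple rank of `(Q_1, …, Q_k)` in `gl_∞` is the supremum over `n` of the tuple
ranks of the tuples of top-left `n × n` corners. -/
theorem tupleRankInf_eq_iSup_tupleRankFin {K : Type*} [Field K] (k : ℕ)
    (Q : Fin k → ℕ → ℕ → K) :
    tupleRankInf Q = ⨆ n : ℕ, tupleRankFin (fun t => glInfCorner n (Q t)) := by
  apply le_antisymm
  · by_cases htop : (⨆ n : ℕ, tupleRankFin (fun t => glInfCorner n (Q t))) = ⊤
    · rw [htop]; exact le_top
    obtain ⟨r, hr⟩ := ENat.ne_top_iff_exists.mp htop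
    rw [← hr]
    have hY : ∀ n, ∃ μ : Fin k → K, μ ≠ 0 ∧
        (glInfCorner n (fun i j => ∑ t, μ t * Q t i j)).rank ≤ r := by
      intro n
      have h1 : tupleRankFin (fun t => glInfCorner n (Q t)) < ((r + 1 : ℕ) : ℕ∞) := by
        refine lt_of_le_of_lt (le_iSup (fun n => tupleRankFin (fun t => glInfCorner n (Q t))) n) ?_
        rw [← hr]
        exact_mod_cast Nat.lt_succ_self r
      obtain ⟨μ, hμ⟩ := iInf_lt_iff.mp h1
      refine ⟨μ.1, μ.2, ?_⟩
      rw [corner_sum] at hμ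
      exact Nat.lt_succ_iff.mp (by exact_mod_cast hμ)
    let I : ℕ →o Ideal (MvPolynomial (Fin k) K) :=
      { toFun := fun n => Ideal.span {p | ∃ f g : Fin (r + 1) → ℕ, (∀ i, f i < n) ∧
          (∀ i, g i < n) ∧ genMinor Q (r + 1) f g = p}
        monotone' := by
          intro a b hab
          apply Ideal.span_mono
          rintro p ⟨f, g, hf, hg, rfl⟩
          exact ⟨f, g, fun i => (hf i).trans_le hab, fun i => (hg i).trans_le hab, rfl⟩ }
    obtain ⟨N, hN⟩ := monotone_stabilizes_iff_noetherian.mpr inferInstance I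
    obtain ⟨μ, hμ0, hμ⟩ := hY N
    have hvan : I N ≤ RingHom.ker (MvPolynomial.eval μ) := by
      refine Ideal.span_le.mpr ?_
      rintro p ⟨f, g, hf, hg, rfl⟩
      change MvPolynomial.eval μ _ = 0
      rw [eval_genMinor]
      exact aux_minor_zero _ (r + 1) (Nat.lt_succ_iff.mpr hμ) (fun i => ⟨f i, hf i⟩)
        (fun i => ⟨g i, hg i⟩)
    refine (iInf_le _ (⟨μ, hμ0⟩ : {μ : Fin k → K // μ ≠ 0})).trans ?_
    refine iSup_le fun n => ?_
    norm_cast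
    by_contra! hlt
    obtain ⟨f, g, hfg⟩ := aux_minor _ (r + 1) hlt
    have hmem : genMinor Q (r + 1) (fun i => (f i : ℕ)) (fun i => (g i : ℕ)) ∈ I (max N n) :=
      Ideal.subset_span ⟨_, _, fun i => (f i).2.trans_le (le_max_right _ _),
        fun i => (g i).2.trans_le (le_max_right _ _), rfl⟩
    rw [← hN _ (le_max_left _ _)] at hmem
    have h0 : MvPolynomial.eval μ _ = 0 := hvan hmem
    rw [eval_genMinor] at h0
    exact hfg h0
  · refine iSup_le fun n => le_iInf fun μ => ?_
    refine (iInf_le _ μ).trans ?_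
    rw [corner_sum]
    exact le_iSup (fun n => ((glInfCorner n (fun i j => ∑ t, μ.1 t * Q t i j)).rank : ℕ∞)) n
end

section
/- Let K be a field, let V be an n-dimensional vector space over K, let k be a non-negative integer with n ≥ 2(k+1), and let φ : V → V be a linear endomorphism. If for every (k+1)-dimensional subspace W of V the induced map W → V/W (sending w to φ(w) mod W) has a non-trivial kernel, then φ has an eigenvalue whose eigenspace has dimension at least n − k. -/
/-- A functional vanishing at `v` and equal to one at `x`. -/
theorem aux_functional {K V : Type*} [Field K] [AddCommGroup V] [Module K V]
    (v x : V) (hx : ∀ c : K, x ≠ c • v) : ∃ f : V →ₗ[K] K, f v = 0 ∧ f x = 1 := by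
  have hx' : x ∉ Submodule.span K {v} := by
    intro hh
    obtain ⟨c, hc⟩ := Submodule.mem_span_singleton.1 hh
    exact hx c hc.symm
  obtain ⟨f, hf, hle⟩ := Submodule.exists_le_ker_of_notMem hx'
  refine ⟨(f x)⁻¹ • f, ?_, ?_⟩
  · have : f v = 0 := hle (Submodule.mem_span_singleton_self v)
    simp [this]
  · simp [hf]

/-- A vector outside every proper `range (φ - c)`. -/
theorem aux_outside {K V : Type*} [Field K] [AddCommGroup V] [Module K V] [FiniteDimensional K V]
    (φ : V →ₗ[K] V) : ∃ v : V, ∀ c : K, (∃ y, ∀ x, φ x - c • x ≠ y) → ∀ x, φ x - c • x ≠ v := by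
  classical
  let S := {c : K // ∃ y, ∀ x, φ x - c • x ≠ y}
  have h1 : ∀ c : S, ∃ f : Module.Dual K V, f ≠ 0 ∧ ∀ x, f (φ x) = c.1 * f x := by
    rintro ⟨c, y, hy⟩
    have : y ∉ LinearMap.range (φ - c • LinearMap.id) := by
      rintro ⟨x, hx⟩
      exact hy x (by simpa using hx)
    obtain ⟨f, hf, hle⟩ := Submodule.exists_le_ker_of_notMem this
    refine ⟨f, fun h => hf (by simp [h]), fun x => ?_⟩
    have : f ((φ - c • LinearMap.id : V →ₗ[K] V) x) = 0 := hle ⟨x, rfl⟩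
    simpa [sub_eq_zero] using this
  choose F hF0 hF using h1
  have hli : LinearIndependent K F := by
    refine Module.End.eigenvectors_linearIndependent' (φ.dualMap : Module.End K (Module.Dual K V))
      (fun c : S => c.1) Subtype.val_injective F (fun c => ?_)
    refine ⟨Module.End.mem_eigenspace_iff.2 ?_, hF0 c⟩
    ext x
    simpa using hF c x
  let B := Module.Basis.extend hli.linearIndepOn_id
  let G : Module.Dual K (Module.Dual K V) := B.constr K (fun _ => (1 : K))
  have hG : ∀ c, G (F c) = 1 := by
    intro c
    have hm : F c ∈ hli.linearIndepOn_id.extend (Set.subset_univ _) :=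
      hli.linearIndepOn_id.subset_extend _ ⟨c, rfl⟩
    have h2 : B ⟨F c, hm⟩ = F c := Module.Basis.extend_apply_self _ _
    rw [← h2]
    exact B.constr_basis K _ _
  obtain ⟨v, hv⟩ := (Module.evalEquiv K V).surjective G
  refine ⟨v, fun c hc x hx => ?_⟩
  have h3 := hG ⟨c, hc⟩
  rw [← hv] at h3
  have h4 : F ⟨c, hc⟩ v = 1 := by simpa using h3
  rw [← hx] at h4
  simp [hF] at h4

theorem aux_vector {K V : Type*} [Field K] [AddCommGroup V] [Module K V] [FiniteDimensional K V]
    (φ : V →ₗ[K] V) (hns : ∀ c : K, ∃ x, φ x ≠ c • x) :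
    ∃ v : V, (∀ c : K, φ v ≠ c • v) ∧
      ∀ c : K, (∃ e, e ≠ 0 ∧ φ e = c • e) → ∀ x, φ x - c • x ≠ v := by
  -- injective iff surjective
  have hinj : ∀ c : K, (∃ e, e ≠ 0 ∧ φ e = c • e) ↔ (∃ y, ∀ x, φ x - c • x ≠ y) := by
    intro c
    have := LinearMap.injective_iff_surjective (f := φ - c • LinearMap.id)
    rw [injective_iff_map_eq_zero] at this
    simp only [Function.Surjective, LinearMap.sub_apply, LinearMap.smul_apply, LinearMap.id_apply,
      sub_eq_zero] at this
    have h2 := not_congr this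
    push Not at h2
    constructor
    · rintro ⟨e, he, h⟩
      exact h2.1 ⟨e, h, he⟩
    · intro h
      obtain ⟨e, h, he⟩ := h2.2 h
      exact ⟨e, he, h⟩
  obtain ⟨v, hv⟩ := aux_outside φ
  by_cases hev : ∀ c : K, φ v ≠ c • v
  · exact ⟨v, hev, fun c hc => hv c ((hinj c).1 hc)⟩
  push Not at hev
  obtain ⟨μ, hμ⟩ := hev
  have honly : ∀ c : K, (∃ e, e ≠ 0 ∧ φ e = c • e) → c = μ := by
    intro c hc
    by_contra hne
    refine hv c ((hinj c).1 hc) ((μ - c)⁻¹ • v) ?_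
    have : μ - c ≠ 0 := sub_ne_zero.2 (Ne.symm hne)
    rw [map_smul, hμ, smul_comm c, ← smul_sub, ← sub_smul, smul_smul, inv_mul_cancel₀ this, one_smul]
  by_cases hμe : ∃ e, e ≠ 0 ∧ φ e = μ • e
  · obtain ⟨y, hy⟩ := (hinj μ).1 hμe
    obtain ⟨a, ha⟩ := hns μ
    have key : ∃ w, φ w ≠ μ • w ∧ ∀ x, φ x - μ • x ≠ w := by
      by_cases h1 : ∀ x, φ x - μ • x ≠ a
      · exact ⟨a, ha, h1⟩
      push Not at h1
      obtain ⟨x1, hx1⟩ := h1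
      by_cases h2 : φ y = μ • y
      · refine ⟨a + y, ?_, ?_⟩
        · intro h
          apply ha
          simpa [h2] using h
        · intro x hx
          apply hy (x - x1)
          rw [map_sub, smul_sub]
          have : y = (φ x - μ • x) - (φ x1 - μ • x1) := by rw [hx, hx1]; simp
          rw [this]; abel
      · exact ⟨y, h2, hy⟩
    obtain ⟨w, hw1, hw2⟩ := key
    refine ⟨w, fun c hc => ?_, fun c hc => ?_⟩
    · have hw0 : w ≠ 0 := by rintro rfl; simp at hw1
      have := honly c ⟨w, hw0, hc⟩
      subst this
      exact hw1 hc
    · have := honly c hc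
      subst this
      exact hw2
  · have hno : ∀ c : K, ¬ ∃ e, e ≠ 0 ∧ φ e = c • e := by
      intro c hc
      have := honly c hc
      subst this
      exact hμe hc
    obtain ⟨a, ha⟩ := hns 0
    have ha0 : a ≠ 0 := by rintro rfl; simp at ha
    exact ⟨a, fun c hc => hno c ⟨a, ha0, hc⟩, fun c hc => absurd hc (hno c)⟩

theorem aux_functional2 {K V : Type*} [Field K] [AddCommGroup V] [Module K V]
    [FiniteDimensional K V] (φ : V →ₗ[K] V) (N : ℕ) (hN : 0 < N)
    (hn : Module.finrank K V ≤ 2 * N) (v : V) (hv : ∀ c : K, φ v ≠ c • v) :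
    ∃ f : V →ₗ[K] K, f v = 0 ∧ f (φ v) = 1 ∧
      ∀ c : K, Module.finrank K (Module.End.eigenspace (φ : Module.End K V) c) = N →
        ∃ e, φ e = c • e ∧ f e ≠ 0 := by
  obtain ⟨f0, hf0, hf0'⟩ := aux_functional v (φ v) hv
  have hv0 : v ≠ 0 := by rintro rfl; exact hv 0 (by simp)
  by_cases hex : ∃ c : K, Module.finrank K (Module.End.eigenspace (φ : Module.End K V) c) = N
  swap
  · exact ⟨f0, hf0, hf0', fun c hc => absurd ⟨c, hc⟩ hex⟩
  obtain ⟨c0, hc0⟩ := hex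
  have : ∃ e, e ≠ 0 ∧ φ e = c0 • e := by
    have hne : Module.End.eigenspace (φ : Module.End K V) c0 ≠ ⊥ := by
      intro h
      rw [h, finrank_bot] at hc0
      omega
    obtain ⟨e, he, he0⟩ := Submodule.exists_mem_ne_zero_of_ne_bot hne
    exact ⟨e, he0, Module.End.mem_eigenspace_iff.1 he⟩
  obtain ⟨e, he0, he⟩ := this
  have hev : ∀ c : K, e ≠ c • v := by
    intro c hc
    have hc' : c ≠ 0 := by rintro rfl; simp at hc; exact he0 hc
    apply hv c0
    rw [hc, map_smul, smul_comm] at he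
    exact smul_right_injective V hc' he
  obtain ⟨f1, hf1, hf1'⟩ := aux_functional v e hev
  have key : ∃ f : V →ₗ[K] K, f v = 0 ∧ f (φ v) = 1 ∧ f e ≠ 0 := by
    by_cases h1 : f0 e = 0
    · by_cases h2 : f1 (φ v) = 0
      · exact ⟨f0 + f1, by simp [hf0, hf1], by simp [hf0', h2], by simp [h1, hf1']⟩
      · exact ⟨(f1 (φ v))⁻¹ • f1, by simp [hf1], by simp [h2], by simp [hf1', h2]⟩
    · exact ⟨f0, hf0, hf0', h1⟩
  obtain ⟨f, hfv, hfφ, hfe⟩ := key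
  refine ⟨f, hfv, hfφ, fun c hc => ?_⟩
  by_cases hcc : c = c0
  · subst hcc; exact ⟨e, he, hfe⟩
  by_contra hcon
  push Not at hcon
  have hdisj : Module.End.eigenspace (φ : Module.End K V) c ⊓
      Module.End.eigenspace (φ : Module.End K V) c0 = ⊥ := by
    rw [eq_bot_iff]
    rintro x ⟨hx1, hx2⟩
    have h1 := Module.End.mem_eigenspace_iff.1 hx1
    have h2 := Module.End.mem_eigenspace_iff.1 hx2
    rw [h1, ← sub_eq_zero, ← sub_smul, smul_eq_zero] at h2
    exact h2.resolve_left (sub_ne_zero.2 hcc)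
  have hsum := Submodule.finrank_sup_add_finrank_inf_eq
    (Module.End.eigenspace (φ : Module.End K V) c) (Module.End.eigenspace (φ : Module.End K V) c0)
  rw [hdisj, finrank_bot, hc, hc0] at hsum
  have htop : Module.End.eigenspace (φ : Module.End K V) c ⊔
      Module.End.eigenspace (φ : Module.End K V) c0 = ⊤ := by
    apply Submodule.eq_top_of_finrank_eq
    apply le_antisymm (Submodule.finrank_le _)
    omega
  have hvm : v ∈ Module.End.eigenspace (φ : Module.End K V) c ⊔
      Module.End.eigenspace (φ : Module.End K V) c0 := by rw [htop]; trivial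
  obtain ⟨v1, hv1, v2, hv2, rfl⟩ := Submodule.mem_sup.1 hvm
  have h1 := Module.End.mem_eigenspace_iff.1 hv1
  have h2 := Module.End.mem_eigenspace_iff.1 hv2
  have h3 := hcon v1 h1
  have h4 : f v2 = 0 := by simpa [h3] using hfv
  have : f (φ (v1 + v2)) = 0 := by rw [map_add, h1, h2]; simp [h3, h4]
  rw [this] at hfφ
  exact zero_ne_one hfφ

theorem aux_main {K : Type*} [Field K] (m : ℕ) :
    ∀ {V : Type*} [AddCommGroup V] [Module K V] [FiniteDimensional K V] (φ : V →ₗ[K] V),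
    2 * m ≤ Module.finrank K V →
    (∀ c : K, Module.finrank K (Module.End.eigenspace (φ : Module.End K V) c) + m
      ≤ Module.finrank K V) →
    ∃ W : Submodule K V, Module.finrank K W = m ∧ ∀ w ∈ W, φ w ∈ W → w = 0 := by
  induction m with
  | zero =>
    intro V _ _ _ φ _ _
    exact ⟨⊥, by simp, fun w hw _ => by simpa using hw⟩
  | succ m ih =>
    intro V _ _ _ φ hn hg
    have hns : ∀ c : K, ∃ x, φ x ≠ c • x := by
      intro c
      by_contra hcon
      push Not at hcon
      have : Module.End.eigenspace (φ : Module.End K V) c = ⊤ := by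
        rw [eq_top_iff]
        intro x _
        exact Module.End.mem_eigenspace_iff.2 (hcon x)
      have h2 := hg c
      rw [this, finrank_top] at h2
      omega
    obtain ⟨v, hv, hvr⟩ := aux_vector φ hns
    have hv0 : v ≠ 0 := by rintro rfl; exact hv 0 (by simp)
    rcases Nat.eq_zero_or_pos m with rfl | hm
    · refine ⟨Submodule.span K {v}, by simpa using finrank_span_singleton hv0, ?_⟩
      intro w hw hφw
      obtain ⟨a, rfl⟩ := Submodule.mem_span_singleton.1 hw
      obtain ⟨b, hb⟩ := Submodule.mem_span_singleton.1 hφw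
      by_contra hne
      have ha : a ≠ 0 := by rintro rfl; simp at hne
      apply hv (a⁻¹ * b)
      rw [mul_smul, hb, map_smul, smul_smul, inv_mul_cancel₀ ha, one_smul]
    obtain ⟨N, hN⟩ : ∃ N, Module.finrank K V = N + (m + 1) := ⟨_, (Nat.sub_add_cancel (by omega)).symm⟩
    obtain ⟨f, hfv, hfφ, hfN⟩ := aux_functional2 φ N (by omega) (by omega) v hv
    obtain ⟨g, hgφ, hgv⟩ : ∃ g : V →ₗ[K] K, g (φ v) = 0 ∧ g v = 1 := by
      apply aux_functional
      intro c hc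
      have : c = 0 := by
        have := congrArg f hc
        simpa [hfv, hfφ] using this.symm
      subst this
      simp at hc
      exact hv0 hc
    let C : Submodule K V := LinearMap.ker (f.prod g)
    have hC : ∀ x, x ∈ C ↔ f x = 0 ∧ g x = 0 := by
      intro x; simp [C]
    have hCdim : Module.finrank K C + 2 = Module.finrank K V := by
      have hs : LinearMap.range (f.prod g) = ⊤ := by
        rw [LinearMap.range_eq_top]
        rintro ⟨a, b⟩
        exact ⟨a • φ v + b • v, by simp [hfv, hfφ, hgφ, hgv]⟩
      have := LinearMap.finrank_range_add_finrank_ker (f.prod g)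
      rw [hs, finrank_top] at this
      simp at this
      change Module.finrank K (LinearMap.ker (f.prod g)) + 2 = _
      omega
    let π : V →ₗ[K] V := LinearMap.id - g.smulRight v - f.smulRight (φ v)
    have hπ : ∀ x, π x = x - g x • v - f x • φ v := by intro x; simp [π]
    have hπC : ∀ x, π x ∈ C := by
      intro x
      rw [hC, hπ]
      simp [hfv, hfφ, hgφ, hgv]
    let ψ : C →ₗ[K] C := (π ∘ₗ φ ∘ₗ C.subtype).codRestrict C (fun x => hπC _)
    have hψ : ∀ x : C, ((ψ x : C) : V) = φ x - g (φ x) • v - f (φ x) • φ v := by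
      intro x
      rw [← hπ]; rfl
    have hψg : ∀ c : K, Module.finrank K (Module.End.eigenspace (ψ : Module.End K C) c) + m
        ≤ Module.finrank K C := by
      intro c
      have hgc := hg c
      -- the basic identity
      have hid : ∀ x ∈ Module.End.eigenspace (ψ : Module.End K C) c,
          φ ((x : V) - f (φ x) • v) - c • ((x : V) - f (φ x) • v)
            = (g (φ x) + c * f (φ x)) • v := by
        intro x hx
        have h1 := congrArg (Subtype.val) (Module.End.mem_eigenspace_iff.1 hx)
        rw [hψ] at h1
        have h2 : φ (x : V) = c • (x : V) + g (φ x) • v + f (φ x) • φ v := by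
          have h3 : φ (x : V) - g (φ x) • v - f (φ x) • φ v = c • (x : V) := h1
          rw [← h3]; abel
        rw [map_sub, map_smul]
        generalize g (φ x) = a at *
        generalize f (φ x) = b at *
        rw [h2]
        module
      by_cases hce : ∃ e, e ≠ 0 ∧ φ e = c • e
      · -- eigenvalue
        have hs : ∀ x ∈ Module.End.eigenspace (ψ : Module.End K C) c,
            φ ((x : V) - f (φ x) • v) = c • ((x : V) - f (φ x) • v) := by
          intro x hx
          have h1 := hid x hx
          by_cases h0 : g (φ x) + c * f (φ x) = 0
          · rw [h0, zero_smul, sub_eq_zero] at h1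
            exact h1
          · exfalso
            refine hvr c hce ((g (φ x) + c * f (φ x))⁻¹ • ((x : V) - f (φ x) • v)) ?_
            rw [map_smul, smul_comm c, ← smul_sub, h1, smul_smul, inv_mul_cancel₀ h0, one_smul]
        let T : C →ₗ[K] V := C.subtype - (f ∘ₗ φ ∘ₗ C.subtype).smulRight v
        have hT : ∀ x : C, T x = (x : V) - f (φ x) • v := by intro x; simp [T]
        have hTinj : Function.Injective T := by
          rw [injective_iff_map_eq_zero]
          intro x hx
          have hx' := hx
          rw [hT] at hx
          have h1 := congrArg g hx
          have h2 := ((hC x).1 x.2).2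
          simp [h2, hgv] at h1
          rw [h1] at hx
          simpa using hx
        have hle : (Module.End.eigenspace (ψ : Module.End K C) c).map T ≤
            Module.End.eigenspace (φ : Module.End K V) c ⊓ LinearMap.ker f := by
          rintro _ ⟨x, hx, rfl⟩
          refine ⟨Module.End.mem_eigenspace_iff.2 ?_, ?_⟩
          · rw [hT]; exact hs x hx
          · simp [hT, hfv, ((hC x).1 x.2).1]
        have hfr := Submodule.finrank_mono hle
        rw [← (Submodule.equivMapOfInjective T hTinj _).finrank_eq] at hfr
        by_cases hb : Module.finrank K (Module.End.eigenspace (φ : Module.End K V) c) = N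
        · obtain ⟨e, he, hfe⟩ := hfN c hb
          have hlt : Module.End.eigenspace (φ : Module.End K V) c ⊓ LinearMap.ker f <
              Module.End.eigenspace (φ : Module.End K V) c := by
            refine lt_of_le_of_ne inf_le_left (fun h => hfe ?_)
            have : e ∈ Module.End.eigenspace (φ : Module.End K V) c :=
              Module.End.mem_eigenspace_iff.2 he
            rw [← h] at this
            exact this.2
          have := Submodule.finrank_lt_finrank_of_lt hlt
          omega
        · have := Submodule.finrank_mono (inf_le_left :
            Module.End.eigenspace (φ : Module.End K V) c ⊓ LinearMap.ker f ≤ _)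
          omega
      · push Not at hce
        let s : C →ₗ[K] K := (g + c • f) ∘ₗ φ ∘ₗ C.subtype
        have hinj : Function.Injective
            (s ∘ₗ (Module.End.eigenspace (ψ : Module.End K C) c).subtype) := by
          rw [injective_iff_map_eq_zero]
          rintro ⟨x, hx⟩ h0
          have h0' : g (φ x) + c * f (φ x) = 0 := by simpa [s] using h0
          have h1 := hid x hx
          rw [h0', zero_smul, sub_eq_zero] at h1
          have h2 : (x : V) - f (φ x) • v = 0 := by
            by_contra hne
            exact hce _ hne h1
          have h3 := congrArg g h2
          simp [((hC x).1 x.2).2, hgv] at h3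
          rw [h3] at h2
          have h4 : (x : V) = 0 := by simpa using h2
          apply Subtype.ext
          apply Subtype.ext
          exact h4
        have := LinearMap.finrank_le_finrank_of_injective hinj
        rw [Module.finrank_self] at this
        omega
    obtain ⟨W1, hW1, hW1'⟩ := ih ψ (by omega) hψg
    refine ⟨Submodule.span K {v} ⊔ W1.map C.subtype, ?_, ?_⟩
    · have hd : Submodule.span K {v} ⊓ W1.map C.subtype = ⊥ := by
        rw [eq_bot_iff]
        rintro x ⟨hx1, y, hy, rfl⟩
        obtain ⟨a, ha⟩ := Submodule.mem_span_singleton.1 hx1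
        have h1 := congrArg g ha
        have h2 := ((hC y).1 y.2).2
        simp [h2, hgv] at h1
        rw [h1] at ha
        simpa using ha.symm
      have := Submodule.finrank_sup_add_finrank_inf_eq (Submodule.span K {v}) (W1.map C.subtype)
      rw [hd, finrank_bot, finrank_span_singleton hv0, ← (Submodule.equivMapOfInjective C.subtype C.injective_subtype W1).finrank_eq, hW1] at this
      omega
    · intro w hw hφw
      obtain ⟨w1, hw1, w2, ⟨x, hx, rfl⟩, rfl⟩ := Submodule.mem_sup.1 hw
      obtain ⟨u1, hu1, u2, ⟨y, hy, rfl⟩, hu⟩ := Submodule.mem_sup.1 hφw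
      obtain ⟨a, rfl⟩ := Submodule.mem_span_singleton.1 hw1
      obtain ⟨b, rfl⟩ := Submodule.mem_span_singleton.1 hu1
      have hu' : b • v + (y : V) = a • φ v + φ x := by simpa using hu
      have hyx : ψ x = y := by
        apply Subtype.ext
        rw [hψ]
        have h1 := congrArg f hu'
        have h2 := congrArg g hu'
        simp [hfv, hfφ, hgv, hgφ, ((hC y).1 y.2).1, ((hC y).1 y.2).2] at h1 h2
        have h3 : f (φ x) = -a := by linear_combination -h1
        rw [← h2, h3]
        have : φ (x : V) = b • v + (y : V) - a • φ v := by rw [hu']; abel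
        rw [this]; module
      have hx0 : x = 0 := hW1' x hx (hyx ▸ hy)
      subst hx0
      have h1 := congrArg f hu'
      simp [hfv, hfφ, ((hC y).1 y.2).1] at h1
      simp [← h1]

/-- If `φ : V → V` with `dim V = n ≥ 2(k+1)` is such that for every `(k+1)`-dimensional
subspace `W` the induced map `W → V/W` has a non-trivial kernel, then `φ` has an
eigenvalue whose eigenspace has dimension at least `n - k`. -/
theorem eigenspace_large_of_induced_maps_not_injective
    {K V : Type*} [Field K] [AddCommGroup V] [Module K V] [FiniteDimensional K V]
    (n k : ℕ) (hdim : Module.finrank K V = n) (hnk : 2 * (k + 1) ≤ n)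
    (φ : V →ₗ[K] V)
    (h : ∀ W : Submodule K V, Module.finrank K W = k + 1 →
      ∃ w ∈ W, w ≠ 0 ∧ φ w ∈ W) :
    ∃ lam : K,
      n - k ≤ Module.finrank K (Module.End.eigenspace (φ : Module.End K V) lam) := by
  by_contra hcon
  push Not at hcon
  obtain ⟨W, hW, hW'⟩ := aux_main (k + 1) φ (by omega) (fun c => by have := hcon c; omega)
  obtain ⟨w, hw, hw0, hφ⟩ := h W hW
  exact hw0 (hW' w hw hφ)
end

section
/- Let K be an infinite field, let k, m, n be non-negative integers with n ≥ 2m ≥ 2(k+1), let 𝒦, 𝒧 be disjoint subsets of {1,...,n} of size m, and let P be an n×n matrix over K. Then rk(P, I_n) ≤ k (i.e., there exists λ ∈ K with rk(P − λ I_n) ≤ k, or rk(P) ≤ k taking the infimum over the projective line through P and I_n) if and only if for every matrix Q similar to P, the submatrix Q_{𝒦,𝒧} (rows indexed by 𝒦, columns indexed by 𝒧) has rank at most k. -/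
open scoped ENat

/-- The rank of the pair `(P, Q)` of `n × n` matrices: the infimum over `(μ₁ : μ₂) ∈ ℙ¹`
of the rank of `μ₁ P + μ₂ Q`. -/
noncomputable def pairRank {K : Type*} [Field K] {n : ℕ}
    (P Q : Matrix (Fin n) (Fin n) K) : ℕ∞ :=
  ⨅ μ : {μ : K × K // μ ≠ 0}, ((μ.1.1 • P + μ.1.2 • Q).rank : ℕ∞)

section Aux
open Module Submodule

variable {K E : Type*} [Field K] [AddCommGroup E] [Module K E] [FiniteDimensional K E]

def OffValid (f : E →ₗ[K] E) (s : ℕ) : Prop :=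
  ∃ V : Submodule K E, finrank K V ≤ s ∧ 2 * s ≤ finrank K (V ⊔ V.map f : Submodule K E)

lemma aux_fr_sup_le (U V : Submodule K E) :
    finrank K (U ⊔ V : Submodule K E) ≤ finrank K U + finrank K V :=
  Submodule.finrank_add_le_finrank_add_finrank U V

lemma aux_fr_span_le (x : E) : finrank K (K ∙ x) ≤ 1 := by
  simpa using finrank_span_le_card (R := K) ({x} : Set E)

lemma aux_fr_lt (U : Submodule K E) (x : E) (hx : x ∉ U) :
    finrank K U + 1 ≤ finrank K (U ⊔ (K ∙ x) : Submodule K E) := by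
  apply Submodule.finrank_lt_finrank_of_lt
  refine lt_of_le_of_ne le_sup_left ?_
  intro h
  apply hx
  rw [h]
  exact mem_sup_right (mem_span_singleton_self x)

lemma aux_shift (f : E →ₗ[K] E) (c : K) (s : ℕ)
    (h : OffValid (f - c • LinearMap.id) s) : OffValid f s := by
  obtain ⟨V, h1, h2⟩ := h
  refine ⟨V, h1, h2.trans (Submodule.finrank_mono ?_)⟩
  refine sup_le le_sup_left ?_
  rintro _ ⟨v, hv, rfl⟩
  simp only [LinearMap.sub_apply, LinearMap.smul_apply, LinearMap.id_apply]
  exact sub_mem (mem_sup_right (mem_map_of_mem hv)) (mem_sup_left (smul_mem _ _ hv))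

lemma aux_scalar (f : E →ₗ[K] E) (W : Submodule K E)
    (hW : finrank K W + 2 ≤ finrank K E)
    (h : ∀ x, x ∉ W → f x ∈ W ⊔ (K ∙ x)) :
    ∃ c : K, ∀ x, f x - c • x ∈ W := by
  have h' : ∀ x, x ∉ W → ∃ c : K, f x - c • x ∈ W := by
    intro x hx
    obtain ⟨w, hw, z, hz, hwz⟩ := mem_sup.1 (h x hx)
    obtain ⟨c, rfl⟩ := mem_span_singleton.1 hz
    exact ⟨c, by rw [← hwz]; simpa using hw⟩
  have hex : ∀ U : Submodule K E, finrank K U < finrank K E → ∃ x, x ∉ U := by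
    intro U hU
    by_contra! hc
    have : U = ⊤ := by ext; simp [hc]
    rw [this, finrank_top] at hU
    exact lt_irrefl _ hU
  obtain ⟨x0, hx0⟩ := hex W (by omega)
  have h01 : finrank K (W ⊔ (K ∙ x0) : Submodule K E) < finrank K E := by
    have := aux_fr_sup_le W (K ∙ x0)
    have := aux_fr_span_le (K := K) x0
    omega
  obtain ⟨x1, hx1⟩ := hex _ h01
  obtain ⟨c, hc⟩ := h' x0 hx0
  have key : ∀ x, x ∉ W ⊔ (K ∙ x0) → f x - c • x ∈ W := by
    intro x hx
    have hxW : x ∉ W := fun hh => hx (mem_sup_left hh)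
    obtain ⟨d, hd⟩ := h' x hxW
    have hsW : x + x0 ∉ W := by
      intro hh
      apply hx
      have : x = (x + x0) - x0 := by abel
      rw [this]
      exact sub_mem (mem_sup_left hh) (mem_sup_right (mem_span_singleton_self x0))
    obtain ⟨e, he⟩ := h' _ hsW
    have h1 : (e - d) • x + (e - c) • x0 ∈ W := by
      have := sub_mem (add_mem hd hc) he
      convert this using 1
      rw [map_add]; module
    have hed : e = d := by
      by_contra hne
      apply hx
      have hne' : e - d ≠ 0 := sub_ne_zero.2 hne
      have : x = (e - d)⁻¹ • (((e - d) • x + (e - c) • x0) - (e - c) • x0) := by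
        rw [add_sub_cancel_right, smul_smul, inv_mul_cancel₀ hne', one_smul]
      rw [this]
      exact smul_mem _ _ (sub_mem (mem_sup_left h1)
        (mem_sup_right (smul_mem _ _ (mem_span_singleton_self x0))))
    subst hed
    have hec : e = c := by
      by_contra hne
      have hne' : e - c ≠ 0 := sub_ne_zero.2 hne
      rw [sub_self, zero_smul, zero_add] at h1
      exact hx0 ((smul_mem_iff _ hne').1 h1)
    subst hec
    exact hd
  refine ⟨c, fun x => ?_⟩
  by_cases hx : x ∈ W ⊔ (K ∙ x0)
  · have h2 : x + x1 ∉ W ⊔ (K ∙ x0) := by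
      intro hh
      exact hx1 ((Submodule.add_mem_iff_right _ hx).1 hh)
    have := sub_mem (key _ h2) (key _ hx1)
    convert this using 1
    rw [map_add]; module
  · exact key x hx

lemma aux_step2 [Infinite K] (N : E →ₗ[K] E) (s : ℕ) (hn : 2 * s + 2 ≤ finrank K E)
    (V : Submodule K E) (hV : finrank K V ≤ s)
    (hW : 2 * s ≤ finrank K (V ⊔ V.map N : Submodule K E))
    (hN : ∀ x, N x ∈ V ⊔ V.map N)
    (hr : s + 1 ≤ finrank K (LinearMap.range N)) : OffValid N (s + 1) := by
  set W := V ⊔ V.map N with hWdef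
  have hmap : finrank K (V.map N) ≤ finrank K V := finrank_map_le N V
  have hW2 : finrank K W ≤ 2 * s := by
    have : finrank K W ≤ _ := aux_fr_sup_le V (V.map N)
    omega
  have hex : ∀ U : Submodule K E, finrank K U < finrank K E → ∃ x, x ∉ U := by
    intro U hU
    by_contra! hc
    have : U = ⊤ := by ext; simp [hc]
    rw [this, finrank_top] at hU
    exact lt_irrefl _ hU
  obtain ⟨x0, hx0⟩ := hex W (by omega)
  -- a vector outside `W` whose image is not in `N V`
  have hx1 : ∃ x, x ∉ W ∧ N x ∉ V.map N := by
    by_contra! hc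
    have : LinearMap.range N ≤ V.map N := by
      rintro _ ⟨x, rfl⟩
      by_cases hx : x ∈ W
      · have h2 : x + x0 ∉ W := fun hh => hx0 ((Submodule.add_mem_iff_right _ hx).1 hh)
        have := sub_mem (hc _ h2) (hc _ hx0)
        simpa using this
      · exact hc x hx
    have := Submodule.finrank_mono this
    omega
  obtain ⟨x1, hx1W, hx1N⟩ := hx1
  obtain ⟨a, haV, _, ⟨b, hb, rfl⟩, hab⟩ := mem_sup.1 (hN x1)
  have ha0 : a ≠ 0 := by
    rintro rfl
    apply hx1N
    rw [← hab, zero_add]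
    exact mem_map_of_mem hb
  obtain ⟨x, hxW, hNx⟩ : ∃ x, x ∉ W ∧ N x = a := by
    refine ⟨x1 - b, fun hh => hx1W ?_, by rw [map_sub, ← hab]; abel⟩
    have := add_mem hh (mem_sup_left hb : b ∈ W)
    simpa using this
  have h01 : finrank K (W ⊔ (K ∙ x) : Submodule K E) < finrank K E := by
    have := aux_fr_sup_le W (K ∙ x)
    have := aux_fr_span_le (K := K) x
    omega
  obtain ⟨y, hy⟩ := hex _ h01
  obtain ⟨C, hC⟩ := Submodule.exists_isCompl (K ∙ a)
  have haV' : (K ∙ a) ≤ V := by simpa [span_singleton_le_iff_mem] using haV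
  set V2 := C ⊓ V with hV2
  have hVeq : V = (K ∙ a) ⊔ V2 := by
    rw [hV2, ← sup_inf_assoc_of_le C haV', hC.sup_eq_top, top_inf_eq]
  have haV2 : a ∉ V2 := by
    intro hh
    have := Submodule.disjoint_def.1 hC.disjoint a (mem_span_singleton_self a) hh.1
    exact ha0 this
  have hV2r : finrank K V2 + 1 ≤ s := by
    have := aux_fr_lt V2 a haV2
    rw [sup_comm, ← hVeq] at this
    omega
  set Z := V ⊔ V2.map N with hZ
  have hZr : finrank K Z + 1 ≤ 2 * s := by
    have : finrank K Z ≤ _ := aux_fr_sup_le V (V2.map N)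
    have : finrank K (V2.map N) ≤ finrank K V2 := finrank_map_le N V2
    omega
  have hWZ : W = Z ⊔ (K ∙ N a) := by
    rw [hWdef, hZ, sup_assoc]
    congr 1
    conv_lhs => rw [hVeq]
    rw [Submodule.map_sup, Submodule.map_span, Set.image_singleton, sup_comm]
  have hZr2 : 2 * s ≤ finrank K Z + 1 := by
    have := aux_fr_sup_le Z (K ∙ N a)
    have := aux_fr_span_le (K := K) (N a)
    rw [← hWZ] at *
    omega
  have hNaZ : N a ∉ Z := by
    intro hh
    have : W = Z := by
      rw [hWZ]; exact sup_eq_left.2 (by simpa [span_singleton_le_iff_mem] using hh)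
    rw [this] at hW
    omega
  obtain ⟨t, ht0, ht⟩ : ∃ t : K, t ≠ 0 ∧ N a + t • N y ∉ Z := by
    obtain ⟨t1, ht1⟩ := Infinite.exists_notMem_finset ({0} : Finset K)
    obtain ⟨t2, ht2⟩ := by
      classical exact Infinite.exists_notMem_finset ({0, t1} : Finset K)
    by_contra! hc
    have h1 := hc t1 (by simpa using ht1)
    have h2 := hc t2 (by simp at ht2; tauto)
    have h12 : t2 - t1 ≠ 0 := sub_ne_zero.2 (by simp at ht2; tauto)
    have h3 : (t2 - t1) • N y ∈ Z := by
      have := sub_mem h2 h1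
      convert this using 1
      module
    have h4 := (smul_mem_iff _ h12).1 h3
    exact hNaZ ((Submodule.add_mem_iff_left _ (smul_mem _ _ h4)).1 h1)
  have hW3 : Z ⊔ (K ∙ (N a + t • N y)) = W := by
    apply Submodule.eq_of_le_of_finrank_le
    · refine sup_le (hWZ ▸ le_sup_left) ?_
      rw [span_singleton_le_iff_mem]
      exact add_mem (hN a) (smul_mem _ _ (hN y))
    · have := aux_fr_lt Z _ ht
      omega
  set V' := V2 ⊔ (K ∙ (a + t • y)) ⊔ (K ∙ x) with hV'
  refine ⟨V', ?_, ?_⟩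
  · have h1 : finrank K V' ≤ _ := aux_fr_sup_le (V2 ⊔ (K ∙ (a + t • y))) (K ∙ x)
    have h2 := aux_fr_sup_le V2 (K ∙ (a + t • y))
    have h3 := aux_fr_span_le (K := K) x
    have h4 := aux_fr_span_le (K := K) (a + t • y)
    omega
  · have h1 := aux_fr_lt W x hxW
    have h2 := aux_fr_lt _ y hy
    refine le_trans (b := finrank K (W ⊔ (K ∙ x) ⊔ (K ∙ y) : Submodule K E)) (by omega) ?_
    apply Submodule.finrank_mono
    have e1 : V2 ≤ V' := le_sup_left.trans le_sup_left
    have e2 : a + t • y ∈ V' := mem_sup_left (mem_sup_right (mem_span_singleton_self _))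
    have e3 : x ∈ V' := mem_sup_right (mem_span_singleton_self _)
    have e4 : a ∈ V' ⊔ V'.map N := by
      rw [← hNx]; exact mem_sup_right (mem_map_of_mem e3)
    have e5 : y ∈ V' ⊔ V'.map N := by
      have := (Submodule.add_mem_iff_right _ e4).1 (mem_sup_left e2 : a + t • y ∈ V' ⊔ V'.map N)
      exact (smul_mem_iff _ ht0).1 this
    refine sup_le (sup_le ?_ ?_) ?_
    · rw [← hW3]
      refine sup_le (sup_le ?_ ?_) ?_
      · rw [hVeq]
        refine sup_le ?_ (e1.trans le_sup_left)
        rwa [span_singleton_le_iff_mem]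
      · exact (Submodule.map_mono e1).trans le_sup_right
      · rw [span_singleton_le_iff_mem]
        apply mem_sup_right
        refine ⟨_, e2, by simp⟩
    · rw [span_singleton_le_iff_mem]; exact mem_sup_left e3
    · rwa [span_singleton_le_iff_mem]

lemma aux_step [Infinite K] (f : E →ₗ[K] E) (s : ℕ) (hn : 2 * s + 2 ≤ finrank K E)
    (hr : ∀ c : K, s + 1 ≤ finrank K (LinearMap.range (f - c • LinearMap.id)))
    (h : OffValid f s) : OffValid f (s + 1) := by
  obtain ⟨V, hV, hW⟩ := h
  by_contra hcon
  have hmap : finrank K (V.map f) ≤ finrank K V := finrank_map_le f V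
  have hW2 : finrank K (V ⊔ V.map f : Submodule K E) ≤ 2 * s := by
    have := aux_fr_sup_le V (V.map f)
    omega
  have h1 : ∀ x, x ∉ V ⊔ V.map f → f x ∈ (V ⊔ V.map f) ⊔ (K ∙ x) := by
    intro x hx
    by_contra hfx
    apply hcon
    refine ⟨V ⊔ (K ∙ x), ?_, ?_⟩
    · have h1 := aux_fr_sup_le V (K ∙ x)
      have h3 := aux_fr_span_le (K := K) x
      omega
    · have h1 := aux_fr_lt _ x hx
      have h2 := aux_fr_lt _ _ hfx
      refine le_trans (by omega) (h2.trans (Submodule.finrank_mono ?_))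
      rw [Submodule.map_sup, Submodule.map_span, Set.image_singleton]
      refine sup_le (sup_le (sup_le ?_ ?_) ?_) ?_
      · exact le_sup_left.trans le_sup_left
      · exact le_sup_left.trans le_sup_right
      · exact le_sup_right.trans le_sup_left
      · exact le_sup_right.trans le_sup_right
  obtain ⟨c, hc⟩ := aux_scalar f _ (by omega) h1
  have hle : V ⊔ V.map f ≤ V ⊔ V.map (f - c • LinearMap.id) := by
    refine sup_le le_sup_left ?_
    rintro _ ⟨v, hv, rfl⟩
    have : f v = (f - c • (LinearMap.id : E →ₗ[K] E)) v + c • v := by simp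
    rw [this]
    exact add_mem (mem_sup_right (mem_map_of_mem hv)) (mem_sup_left (smul_mem _ _ hv))
  apply hcon
  apply aux_shift f c
  refine aux_step2 _ s hn V hV (hW.trans (Submodule.finrank_mono hle)) ?_ (hr c)
  intro x
  exact hle (by simpa using hc x)

lemma aux_valid [Infinite K] (f : E →ₗ[K] E) (r : ℕ) (hn : 2 * r ≤ finrank K E)
    (hr : ∀ c : K, r ≤ finrank K (LinearMap.range (f - c • LinearMap.id))) :
    OffValid f r := by
  have : ∀ s, s ≤ r → OffValid f s := by
    intro s
    induction s with
    | zero => intro _; exact ⟨⊥, by simp, by simp⟩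
    | succ s ih =>
      intro hs
      exact aux_step f s (by omega) (fun c => hs.trans (hr c)) (ih (by omega))
  exact this r le_rfl

lemma aux_family (f : E →ₗ[K] E) (r : ℕ) (h : OffValid f r) :
    ∃ v : Fin r → E, LinearIndependent K (Sum.elim v (fun i => f (v i))) := by
  obtain ⟨V, hV, hW⟩ := h
  have hmap : finrank K (V.map f) ≤ finrank K V := finrank_map_le f V
  have hVr : finrank K V = r := by
    have := aux_fr_sup_le V (V.map f)
    omega
  let b := finBasisOfFinrankEq K V hVr
  have hsp : span K (Set.range fun i => (b i : E)) = V := by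
    have := congrArg (Submodule.map V.subtype) b.span_eq
    rw [Submodule.map_span, ← Set.range_comp, Submodule.map_subtype_top] at this
    exact this
  refine ⟨fun i => (b i : E), ?_⟩
  rw [linearIndependent_iff_card_le_finrank_span, Set.finrank, Set.Sum.elim_range, span_union,
    hsp]
  have : span K (Set.range fun i => f (b i : E)) = V.map f := by
    conv_rhs => rw [← hsp]
    rw [Submodule.map_span, ← Set.range_comp]
    rfl
  rw [this]
  simp only [Fintype.card_sum, Fintype.card_fin]
  omega

lemma aux_basis {ι : Type} [Fintype ι] {n : ℕ} (hE : finrank K E = n) (w : ι → E)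
    (hw : LinearIndependent K w) (e : ι → Fin n) (he : Function.Injective e) :
    ∃ b : Basis (Fin n) K E, ∀ i, b (e i) = w i := by
  classical
  let B := Basis.sumExtend hw
  haveI : Finite (ι ⊕ Basis.sumExtendIndex hw) := Module.Finite.finite_basis B
  haveI : Finite (Basis.sumExtendIndex hw) := Finite.sum_right ι
  haveI := Fintype.ofFinite (Basis.sumExtendIndex hw)
  have hcard : Fintype.card (ι ⊕ Basis.sumExtendIndex hw) = n := by
    rw [← hE, finrank_eq_card_basis B]
  have e1 : ι ⊕ ((Set.range e)ᶜ : Set (Fin n)) ≃ Fin n :=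
    (Equiv.sumCongr (Equiv.ofInjective e he) (Equiv.refl _)).trans (Equiv.Set.sumCompl _)
  have hc2 : Fintype.card (Basis.sumExtendIndex hw) =
      Fintype.card ((Set.range e)ᶜ : Set (Fin n)) := by
    have := Fintype.card_congr e1
    simp only [Fintype.card_sum, Fintype.card_fin] at this hcard
    omega
  let e2 := Fintype.equivOfCardEq hc2
  let e3 : ι ⊕ Basis.sumExtendIndex hw ≃ Fin n :=
    (Equiv.sumCongr (Equiv.ofInjective e he) e2).trans (Equiv.Set.sumCompl _)
  refine ⟨B.reindex e3, fun i => ?_⟩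
  have : e3.symm (e i) = Sum.inl i := by
    rw [Equiv.symm_apply_eq]
    simp [e3]
  rw [Basis.reindex_apply, this]
  simp only [B, Basis.sumExtend, Basis.reindex_apply, Basis.extend_apply_self]
  rfl

end Aux

/-- `rk(P, I_n) ≤ k` if and only if for every `Q` similar to `P`, the submatrix of `Q`
with rows `𝒦` and columns `𝒦` has rank at most `k`, where `𝒦, 𝒧` are disjoint subsets
of `[n]` of size `m`, with `n ≥ 2m ≥ 2(k+1)`. -/
theorem pairRank_le_iff_offdiagonal_submatrices {K : Type*} [Field K] [Infinite K]
    (k m n : ℕ) (hmn : 2 * m ≤ n) (hkm : k + 1 ≤ m)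
    (Ks Ls : Finset (Fin n)) (hdisj : Disjoint Ks Ls)
    (hK : Ks.card = m) (hL : Ls.card = m)
    (P : Matrix (Fin n) (Fin n) K) :
    pairRank P 1 ≤ (k : ℕ∞) ↔
      ∀ A : (Matrix (Fin n) (Fin n) K)ˣ,
        ((((A : Matrix (Fin n) (Fin n) K) * P * ((A⁻¹ : (Matrix (Fin n) (Fin n) K)ˣ) : Matrix (Fin n) (Fin n) K))).submatrix
          (fun i : {x // x ∈ Ks} => (i : Fin n))
          (fun j : {x // x ∈ Ls} => (j : Fin n))).rank ≤ k := by
  classical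
  constructor
  · intro h A
    have h0 : ∃ μ : {μ : K × K // μ ≠ 0},
        ((μ.1.1 • P + μ.1.2 • (1 : Matrix (Fin n) (Fin n) K)).rank : ℕ∞) ≤ k := by
      by_contra! hc
      have : ((k + 1 : ℕ) : ℕ∞) ≤ pairRank P 1 := by
        refine le_iInf fun μ => ?_
        have := hc μ
        norm_cast at this ⊢
      have := this.trans h
      norm_cast at this
      omega
    obtain ⟨⟨⟨p, q⟩, hpq⟩, hr⟩ := h0
    simp only [Nat.cast_le] at hr
    have hp : p ≠ 0 := by
      rintro rfl
      have hq : q ≠ 0 := by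
        rintro rfl
        exact hpq rfl
      have hu : IsUnit (q • (1 : Matrix (Fin n) (Fin n) K)) := by
        rw [Matrix.isUnit_iff_isUnit_det]
        simp [hq]
      rw [zero_smul, zero_add, Matrix.rank_of_isUnit _ hu, Fintype.card_fin] at hr
      omega
    set Q := (A : Matrix (Fin n) (Fin n) K) * P * ((A⁻¹ : (Matrix (Fin n) (Fin n) K)ˣ) : Matrix (Fin n) (Fin n) K) with hQ
    have hQ2 : (A : Matrix (Fin n) (Fin n) K) * (p • P + q • 1) * ((A⁻¹ : (Matrix (Fin n) (Fin n) K)ˣ) : Matrix (Fin n) (Fin n) K) = p • Q + q • 1 := by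
      rw [mul_add, add_mul, hQ]
      simp
    have hs : Q.submatrix (fun i : {x // x ∈ Ks} => (i : Fin n))
          (fun j : {x // x ∈ Ls} => (j : Fin n)) =
        (p⁻¹ • (p • Q + q • 1)).submatrix (fun i : {x // x ∈ Ks} => (i : Fin n))
          (fun j : {x // x ∈ Ls} => (j : Fin n)) := by
      ext i j
      have hij : (i : Fin n) ≠ j := by
        intro hh
        exact Finset.disjoint_left.1 hdisj i.2 (hh ▸ j.2)
      simp [Matrix.one_apply_ne hij, hp]
    rw [hs, ← hQ2]
    refine (Matrix.rank_submatrix_le _ _ _).trans ?_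
    rw [Matrix.rank_smul_of_mem_nonZeroDivisors _ (mem_nonZeroDivisors_of_ne_zero (inv_ne_zero hp))]
    exact (Matrix.rank_mul_le_left _ _).trans ((Matrix.rank_mul_le_right _ _).trans hr)
  · intro h
    by_contra hcon
    have hr : ∀ c : K, k + 1 ≤ (P - c • (1 : Matrix (Fin n) (Fin n) K)).rank := by
      intro c
      by_contra hc
      apply hcon
      refine (iInf_le _ ⟨(1, -c), by simp⟩).trans ?_
      simp only [one_smul, neg_smul, ← sub_eq_add_neg, Nat.cast_le]
      omega
    obtain ⟨v, hv⟩ := aux_family (Matrix.toLin' P) (k + 1) (aux_valid _ _ (by simp; omega) (by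
      intro c
      have := hr c
      rw [← Matrix.toLin'_one, ← map_smul, ← map_sub]
      exact this))
    obtain ⟨eK⟩ : Nonempty (Fin (k + 1) ↪ {x // x ∈ Ks}) := by
      rw [Function.Embedding.nonempty_iff_card_le]; simp; omega
    obtain ⟨eL⟩ : Nonempty (Fin (k + 1) ↪ {x // x ∈ Ls}) := by
      rw [Function.Embedding.nonempty_iff_card_le]; simp; omega
    obtain ⟨b, hb⟩ := aux_basis (by simp) _ hv
      (Sum.elim (fun i => (eL i : Fin n)) (fun i => (eK i : Fin n))) (by
        refine Function.Injective.sumElim ?_ ?_ ?_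
        · exact Subtype.val_injective.comp eL.injective
        · exact Subtype.val_injective.comp eK.injective
        · intro i j hh
          exact Finset.disjoint_left.1 hdisj (eK j).2 (hh ▸ (eL i).2))
    let S := Pi.basisFun K (Fin n)
    let A : (Matrix (Fin n) (Fin n) K)ˣ :=
      ⟨b.toMatrix S, S.toMatrix b, b.toMatrix_mul_toMatrix_flip S, S.toMatrix_mul_toMatrix_flip b⟩
    have hA := h A
    have hM : (A : Matrix (Fin n) (Fin n) K) * P * ((A⁻¹ : (Matrix (Fin n) (Fin n) K)ˣ) : Matrix (Fin n) (Fin n) K) = LinearMap.toMatrix b b (Matrix.toLin' P) := by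
      rw [← basis_toMatrix_mul_linearMap_toMatrix_mul_basis_toMatrix b S b S]
      have : LinearMap.toMatrix S S (Matrix.toLin' P) = P := LinearMap.toMatrix'_toLin' P
      rw [this]
      rfl
    rw [hM] at hA
    have h1 : (((LinearMap.toMatrix b b (Matrix.toLin' P)).submatrix
        (fun i : {x // x ∈ Ks} => (i : Fin n))
        (fun j : {x // x ∈ Ls} => (j : Fin n))).submatrix eK eL) = 1 := by
      ext i j
      have e1 := hb (Sum.inl j)
      have e2 := hb (Sum.inr j)
      simp only [Sum.elim_inl, Sum.elim_inr] at e1 e2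
      simp only [Matrix.submatrix_apply, LinearMap.toMatrix_apply, e1, ← e2, Module.Basis.repr_self]
      rw [Finsupp.single_apply, Matrix.one_apply]
      congr 1
      simp [eq_comm]
    have h2 := congrArg Matrix.rank h1
    rw [Matrix.rank_one, Fintype.card_fin] at h2
    have h3 := h2.symm.trans_le ((Matrix.rank_submatrix_le _ _ _).trans hA)
    omega
end

section
/- Let K be a field, let k ≤ n be positive integers, and let P be an n×n matrix over K. Then rk(P) < k if and only if for every matrix Q similar to P, the top-left k×k submatrix of Q has determinant zero. -/
open Module in
lemma exists_common_compl_aux {K E : Type*} [Field K] [AddCommGroup E] [Module K E]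
    [FiniteDimensional K E] (d : ℕ) : ∀ U V : Submodule K E,
    finrank K U + d = finrank K E → finrank K V + d = finrank K E →
    ∃ W : Submodule K E, IsCompl U W ∧ IsCompl V W := by
  induction d with
  | zero =>
    intro U V hU hV
    have hU' := Submodule.eq_top_of_finrank_eq (by simpa using hU)
    have hV' := Submodule.eq_top_of_finrank_eq (by simpa using hV)
    subst hU' hV'
    exact ⟨⊥, isCompl_top_bot, isCompl_top_bot⟩
  | succ d ih =>
    intro U V hU hV
    have key : ∃ w, w ∉ U ∧ w ∉ V := by
      by_cases hUV : U ≤ V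
      · have : V ≠ ⊤ := by
          rintro rfl
          simp at hV
        obtain ⟨w, hw⟩ := SetLike.exists_not_mem_of_ne_top V this rfl
        exact ⟨w, fun h => hw (hUV h), hw⟩
      · have hVU : ¬ V ≤ U := fun h => hUV (Submodule.eq_of_le_of_finrank_eq h (by omega)).ge
        obtain ⟨u, hu, hu'⟩ := SetLike.not_le_iff_exists.mp hUV
        obtain ⟨v, hv, hv'⟩ := SetLike.not_le_iff_exists.mp hVU
        refine ⟨u + v, fun h => hv' ?_, fun h => hu' ?_⟩
        · simpa using U.sub_mem h hu
        · simpa using V.sub_mem h hv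
    obtain ⟨w, hwU, hwV⟩ := key
    have hw0 : w ≠ 0 := fun h => hwU (h ▸ U.zero_mem)
    have disj : ∀ X : Submodule K E, w ∉ X → Disjoint X (K ∙ w) := fun X hX =>
      ((Submodule.disjoint_span_singleton' hw0).2 hX)
    have dim : ∀ X : Submodule K E, w ∉ X →
        finrank K (X ⊔ (K ∙ w) : Submodule K E) = finrank K X + 1 := by
      intro X hX
      have h := Submodule.finrank_sup_add_finrank_inf_eq X (K ∙ w)
      rw [(disj X hX).eq_bot, finrank_span_singleton hw0] at h
      simpa using h
    obtain ⟨W, h1, h2⟩ := ih (U ⊔ (K ∙ w)) (V ⊔ (K ∙ w)) (by rw [dim U hwU]; omega)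
      (by rw [dim V hwV]; omega)
    refine ⟨(K ∙ w) ⊔ W, ⟨?_, ?_⟩, ⟨?_, ?_⟩⟩
    · exact (disj U hwU).disjoint_sup_right_of_disjoint_sup_left h1.disjoint
    · rw [codisjoint_iff, ← sup_assoc]; exact h1.sup_eq_top
    · exact (disj V hwV).disjoint_sup_right_of_disjoint_sup_left h2.disjoint
    · rw [codisjoint_iff, ← sup_assoc]; exact h2.sup_eq_top

open Module in
lemma exists_basis_topleft {K : Type*} [Field K] (k n : ℕ) (hkn : k ≤ n)
    (f : (Fin n → K) →ₗ[K] (Fin n → K)) (hf : k ≤ finrank K (LinearMap.range f)) :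
    ∃ b : Basis (Fin n) K (Fin n → K),
      ((LinearMap.toMatrix b b f).submatrix (Fin.castLE hkn) (Fin.castLE hkn)).det ≠ 0 := by
  obtain ⟨g, hg⟩ := exists_linearIndependent_of_le_finrank hf
  choose x hx using fun i => (g i).2
  have hg' : LinearIndependent K (fun i => (g i : Fin n → K)) :=
    hg.map' (LinearMap.range f).subtype (Submodule.ker_subtype _)
  have hxi : LinearIndependent K x := by
    apply LinearIndependent.of_comp f
    convert hg' using 1
    exact funext hx
  have dU := finrank_span_eq_card hg'
  have dV := finrank_span_eq_card hxi
  rw [Fintype.card_fin] at dU dV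
  obtain ⟨W, hU, hV⟩ := exists_common_compl_aux (n - k) _ _
    (show finrank K (Submodule.span K (Set.range (fun i => (g i : Fin n → K)))) + (n - k) =
      finrank K (Fin n → K) by rw [dU]; simp; omega)
    (show finrank K (Submodule.span K (Set.range x)) + (n - k) =
      finrank K (Fin n → K) by rw [dV]; simp; omega)
  have dW : finrank K W = n - k := by
    have := Submodule.finrank_add_eq_of_isCompl hV
    simp at this
    omega
  let b0 : Basis (Fin k ⊕ Fin (n - k)) K (Fin n → K) :=
    ((Basis.span hxi).prod (finBasisOfFinrankEq K W dW)).map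
      (Submodule.prodEquivOfIsCompl _ _ hV)
  let e : Fin k ⊕ Fin (n - k) ≃ Fin n := finSumFinEquiv.trans (finCongr (by omega))
  have he : ∀ i, e (Sum.inl i) = Fin.castLE hkn i := fun i => by
    ext; simp [e]
  have he' : ∀ i, e.symm (Fin.castLE hkn i) = Sum.inl i := fun i => by
    rw [← he]; simp
  have hb0 : ∀ i, b0 (Sum.inl i) = x i := fun i => by
    simp [b0, Basis.span_apply]
  have hb0' : ∀ i, b0 (Sum.inr i) ∈ W := fun i => by
    simp [b0]
  refine ⟨b0.reindex e, fun hdet => ?_⟩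
  obtain ⟨c, hc0, hc⟩ := Matrix.exists_mulVec_eq_zero_iff.mpr hdet
  apply hc0
  let y := ∑ i, c i • (g i : Fin n → K)
  have hy : ∀ i, b0.repr y (Sum.inl i) = 0 := by
    intro i
    have := congrFun hc i
    simp only [Matrix.mulVec, dotProduct, Matrix.submatrix_apply, LinearMap.toMatrix_apply,
      Basis.reindex_apply, he', hb0, hx, Basis.repr_reindex_apply, Pi.zero_apply] at this
    rw [← this]
    simp [y, Finsupp.finset_sum_apply, mul_comm]
  have hyW : y ∈ W := by
    rw [← b0.sum_repr y, Fintype.sum_sum_type]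
    simp only [hy, zero_smul, Finset.sum_const_zero, zero_add]
    exact W.sum_mem fun i _ => W.smul_mem _ (hb0' i)
  have hyU : y ∈ Submodule.span K (Set.range (fun i => (g i : Fin n → K))) :=
    Submodule.sum_mem _ fun i _ => Submodule.smul_mem _ _ (Submodule.subset_span ⟨i, rfl⟩)
  have hy0 : y = 0 := Submodule.disjoint_def.mp hU.disjoint y hyU hyW
  exact funext (Fintype.linearIndependent_iff.mp hg' c hy0)

/-- `rk(P) < k` if and only if for every matrix `Q` similar to `P`, the top-left `k × k`
submatrix of `Q` has determinant zero. -/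
theorem rank_lt_iff_topleft_det_zero_of_similar {K : Type*} [Field K]
    (k n : ℕ) (hk : 0 < k) (hkn : k ≤ n) (P : Matrix (Fin n) (Fin n) K) :
    P.rank < k ↔
      ∀ A : (Matrix (Fin n) (Fin n) K)ˣ,
        (((A : Matrix (Fin n) (Fin n) K) * P *
            ((A⁻¹ : (Matrix (Fin n) (Fin n) K)ˣ) : Matrix (Fin n) (Fin n) K)).submatrix
          (Fin.castLE hkn) (Fin.castLE hkn)).det = 0 := by
  constructor
  · intro h A
    by_contra hd
    have h1 := Matrix.rank_of_isUnit _ ((Matrix.isUnit_iff_isUnit_det _).2 (isUnit_iff_ne_zero.2 hd))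
    rw [Fintype.card_fin] at h1
    have h2 := Matrix.rank_submatrix_le ((A : Matrix (Fin n) (Fin n) K) * P *
            ((A⁻¹ : (Matrix (Fin n) (Fin n) K)ˣ) : Matrix (Fin n) (Fin n) K))
            (Fin.castLE hkn) (Fin.castLE hkn)
    have h3 := Matrix.rank_mul_le_left ((A : Matrix (Fin n) (Fin n) K) * P)
            ((A⁻¹ : (Matrix (Fin n) (Fin n) K)ˣ) : Matrix (Fin n) (Fin n) K)
    have h4 := Matrix.rank_mul_le_right (A : Matrix (Fin n) (Fin n) K) P
    omega
  · intro h
    by_contra hr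
    obtain ⟨b, hb⟩ := exists_basis_topleft k n hkn (Matrix.toLin' P) (not_lt.mp hr)
    let s := Pi.basisFun K (Fin n)
    apply hb
    have := h ⟨b.toMatrix s, s.toMatrix b, b.toMatrix_mul_toMatrix_flip s,
      s.toMatrix_mul_toMatrix_flip b⟩
    rw [← basis_toMatrix_mul_linearMap_toMatrix_mul_basis_toMatrix b s b s]
    have hs : LinearMap.toMatrix s s (Matrix.toLin' P) = P := LinearMap.toMatrix'_toLin' P
    rw [hs]
    exact this
end

section
/- Let K be a field and let P, P' be n×n matrices over K with rk(P), rk(P') ≤ n/2 − 1. Then: (0) for all Q similar to P and Q' similar to P', rk(Q + Q') ≥ |rk(P) − rk(P')|; (1) there exist Q similar to P and Q' similar to P' with rk(Q + Q') = rk(P) + rk(P'); and (2) there exist Q similar to P and Q' similar to P' with rk(Q + Q') ≤ max(rk(P), rk(P')). -/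
/-- Two square matrices are similar if they are conjugate by an invertible matrix. -/
def MatSimilar {K : Type*} [Field K] {n : ℕ} (P Q : Matrix (Fin n) (Fin n) K) : Prop :=
  ∃ A : (Matrix (Fin n) (Fin n) K)ˣ,
    Q = (A : Matrix (Fin n) (Fin n) K) * P * ((A⁻¹ : (Matrix (Fin n) (Fin n) K)ˣ) : Matrix (Fin n) (Fin n) K)

open Module in
theorem aux_exists_map_le {K V : Type*} [Field K] [AddCommGroup V] [Module K V]
    [FiniteDimensional K V] (A B : Submodule K V) (h : finrank K A ≤ finrank K B) :
    ∃ g : V ≃ₗ[K] V, ∀ x ∈ A, g x ∈ B := by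
  obtain ⟨i, hi⟩ := finrank_le_iff_exists_linearMap.1 h
  have hj : Function.Injective (B.subtype ∘ₗ i) := by
    simpa using B.injective_subtype.comp hi
  obtain ⟨g, hg⟩ := Submodule.exists_linearEquiv_restrict_eq
    (LinearEquiv.ofInjective (B.subtype ∘ₗ i) hj)
  refine ⟨g, fun x hx => ?_⟩
  have := hg ⟨x, hx⟩
  simp only [LinearEquiv.ofInjective_apply] at this
  rw [← this]
  simp

/-- Simultaneous general position of two pairs of subspaces. -/
theorem aux_general_position {K V : Type*} [Field K] [AddCommGroup V] [Module K V]
    [FiniteDimensional K V] (I N J M : Submodule K V)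
    (hIJ : Module.finrank K I + Module.finrank K J ≤ Module.finrank K V)
    (k : ℕ) : ∀ g : V ≃ₗ[K] V, N ⊔ M.map (g : V →ₗ[K] V) = ⊤ →
      Module.finrank K (I ⊓ J.map (g : V →ₗ[K] V) : Submodule K V) = k →
    ∃ g : V ≃ₗ[K] V, N ⊔ M.map (g : V →ₗ[K] V) = ⊤ ∧ I ⊓ J.map (g : V →ₗ[K] V) = ⊥ := by
  induction k using Nat.strong_induction_on with
  | _ k ih =>
  intro g hg hk
  by_cases hbot : I ⊓ J.map (g : V →ₗ[K] V) = ⊥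
  · exact ⟨g, hg, hbot⟩
  obtain ⟨v, hv, hv0⟩ := Submodule.exists_mem_ne_zero_of_ne_bot hbot
  set J' := J.map (g : V →ₗ[K] V) with hJ'
  set M' := M.map (g : V →ₗ[K] V) with hM'
  have hJdim : Module.finrank K J' = Module.finrank K J := LinearEquiv.finrank_map_eq g J
  have hpos : 0 < Module.finrank K (I ⊓ J' : Submodule K V) := by
    rw [Nat.pos_iff_ne_zero]
    intro h0
    exact hbot (Submodule.finrank_eq_zero.1 h0)
  have hne : I ⊔ J' ≠ ⊤ := by
    intro h
    have h1 := Submodule.finrank_sup_add_finrank_inf_eq I J'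
    rw [h, finrank_top] at h1
    omega
  obtain ⟨x, hx, hxNM⟩ : ∃ x, x ∉ I ⊔ J' ∧ (x ∈ N ∨ x ∈ M') := by
    by_contra hcon
    push Not at hcon
    apply hne
    rw [eq_top_iff, ← hg]
    refine sup_le (fun y hy => ?_) (fun y hy => ?_)
    · by_contra hy'
      exact (hcon y hy').1 hy
    · by_contra hy'
      exact (hcon y hy').2 hy
  have hvx : v ∉ Submodule.span K {x} := by
    intro h
    obtain ⟨c, rfl⟩ := Submodule.mem_span_singleton.1 h
    have hc : c ≠ 0 := by
      rintro rfl
      simp at hv0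
    apply hx
    have := (I ⊔ J').smul_mem c⁻¹ (Submodule.mem_sup_left (T := J') hv.1)
    rwa [smul_smul, inv_mul_cancel₀ hc, one_smul] at this
  obtain ⟨φ, hφv, hφ⟩ := Submodule.exists_le_ker_of_notMem hvx
  have hφx : φ x = 0 := hφ (Submodule.mem_span_singleton_self x)
  let t : V ≃ₗ[K] V := LinearEquiv.transvection hφx
  have ht : ∀ y, t y = y + φ y • x := fun y => rfl
  have hmap : ∀ A : Submodule K V, A.map ((g.trans t : V ≃ₗ[K] V) : V →ₗ[K] V)
      = (A.map (g : V →ₗ[K] V)).map (t : V →ₗ[K] V) := by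
    intro A
    rw [LinearEquiv.coe_trans, Submodule.map_comp]
  have hN : N ⊔ M.map ((g.trans t : V ≃ₗ[K] V) : V →ₗ[K] V) = ⊤ := by
    rw [hmap, ← hM', eq_top_iff, ← hg]
    refine sup_le le_sup_left (fun y hy => ?_)
    have h1 : t y ∈ M'.map (t : V →ₗ[K] V) := Submodule.mem_map_of_mem hy
    have h2 : y = -(φ y • x) + t y := by rw [ht]; abel
    have h3 : x ∈ N ⊔ M'.map (t : V →ₗ[K] V) := by
      rcases hxNM with h | h
      · exact Submodule.mem_sup_left h
      · refine Submodule.mem_sup_right ⟨x, h, ?_⟩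
        change t x = x
        rw [ht, hφx, zero_smul, add_zero]
    rw [h2]
    exact Submodule.add_mem _ (Submodule.neg_mem _ (Submodule.smul_mem _ _ h3))
      (Submodule.mem_sup_right h1)
  have hlt : I ⊓ J.map ((g.trans t : V ≃ₗ[K] V) : V →ₗ[K] V) < I ⊓ J' := by
    rw [hmap, ← hJ']
    have key : ∀ y ∈ I ⊓ J'.map (t : V →ₗ[K] V), y ∈ I ⊓ J' ∧ φ y = 0 := by
      rintro y ⟨hyI, z, hz, hzy⟩
      change t z = y at hzy
      rw [ht] at hzy
      have hφz : φ z = 0 := by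
        by_contra hne
        apply hx
        have h1 : φ z • x ∈ I ⊔ J' := by
          rw [← eq_sub_iff_add_eq'] at hzy
          rw [hzy]
          exact Submodule.sub_mem _ (Submodule.mem_sup_left hyI) (Submodule.mem_sup_right hz)
        have := (I ⊔ J').smul_mem (φ z)⁻¹ h1
        rwa [smul_smul, inv_mul_cancel₀ hne, one_smul] at this
      rw [hφz, zero_smul, add_zero] at hzy
      subst hzy
      exact ⟨⟨hyI, hz⟩, hφz⟩
    refine lt_of_le_of_ne (fun y hy => (key y hy).1) (fun h => hφv ?_)
    rw [← h] at hv
    exact (key v hv).2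
  exact ih _ (hk ▸ Submodule.finrank_lt_finrank_of_lt hlt) (g.trans t) hN rfl

theorem aux_range_conj {K V : Type*} [Field K] [AddCommGroup V] [Module K V]
    (e : V ≃ₗ[K] V) (f : V →ₗ[K] V) :
    LinearMap.range ((e : V →ₗ[K] V) ∘ₗ f ∘ₗ (e.symm : V →ₗ[K] V))
      = (LinearMap.range f).map (e : V →ₗ[K] V) := by
  rw [LinearMap.range_comp, LinearMap.range_comp_of_range_eq_top _ (LinearEquiv.range _)]

/-- Rank additivity on linear maps. -/
theorem aux_rank_add {K V : Type*} [Field K] [AddCommGroup V] [Module K V]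
    [FiniteDimensional K V] (f f' : V →ₗ[K] V)
    (hN : LinearMap.ker f ⊔ LinearMap.ker f' = ⊤)
    (hI : LinearMap.range f ⊓ LinearMap.range f' = ⊥) :
    Module.finrank K (LinearMap.range (f + f'))
      = Module.finrank K (LinearMap.range f) + Module.finrank K (LinearMap.range f') := by
  have : LinearMap.range (f + f') = LinearMap.range f ⊔ LinearMap.range f' := by
    apply le_antisymm
    · rintro _ ⟨x, rfl⟩
      exact Submodule.add_mem_sup ⟨x, rfl⟩ ⟨x, rfl⟩
    · intro y hy
      obtain ⟨_, ⟨a, rfl⟩, _, ⟨b, rfl⟩, rfl⟩ := Submodule.mem_sup.1 hy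
      have hab : a - b ∈ LinearMap.ker f ⊔ LinearMap.ker f' := hN ▸ Submodule.mem_top
      obtain ⟨p, hp, q, hq, hpq⟩ := Submodule.mem_sup.1 hab
      rw [LinearMap.mem_ker] at hp hq
      refine ⟨a - p, ?_⟩
      have h2 : a - p = b + q := by
        rw [sub_eq_iff_eq_add, add_assoc, add_comm q p, hpq]; abel
      rw [LinearMap.add_apply]
      nth_rw 2 [h2]
      simp [hp, hq]
  have h1 := Submodule.finrank_sup_add_finrank_inf_eq (LinearMap.range f) (LinearMap.range f')
  rw [this]
  rw [hI, finrank_bot] at h1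
  omega

theorem aux_ker_conj {K V : Type*} [Field K] [AddCommGroup V] [Module K V]
    (e : V ≃ₗ[K] V) (f : V →ₗ[K] V) :
    LinearMap.ker ((e : V →ₗ[K] V) ∘ₗ f ∘ₗ (e.symm : V →ₗ[K] V))
      = (LinearMap.ker f).map (e : V →ₗ[K] V) := by
  ext x
  constructor
  · intro hx
    refine ⟨e.symm x, ?_, by simp⟩
    simpa using hx
  · rintro ⟨y, hy, rfl⟩
    have : f y = 0 := hy
    simp [this]

theorem aux_similar {K : Type*} [Field K] {n : ℕ} (P : Matrix (Fin n) (Fin n) K)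
    (e : (Fin n → K) ≃ₗ[K] (Fin n → K)) :
    MatSimilar P (LinearMap.toMatrix' ((e : (Fin n → K) →ₗ[K] (Fin n → K)) ∘ₗ Matrix.toLin' P ∘ₗ
      (e.symm : (Fin n → K) →ₗ[K] (Fin n → K)))) := by
  refine ⟨⟨LinearMap.toMatrix' (e : (Fin n → K) →ₗ[K] (Fin n → K)),
    LinearMap.toMatrix' (e.symm : (Fin n → K) →ₗ[K] (Fin n → K)), ?_, ?_⟩, ?_⟩
  · rw [← LinearMap.toMatrix'_comp]; simp
  · rw [← LinearMap.toMatrix'_comp]; simp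
  · simp [LinearMap.toMatrix'_comp, Matrix.mul_assoc]

theorem aux_similar_refl {K : Type*} [Field K] {n : ℕ} (P : Matrix (Fin n) (Fin n) K) :
    MatSimilar P P := ⟨1, by simp⟩

theorem aux_similar_rank {K : Type*} [Field K] {n : ℕ} {P Q : Matrix (Fin n) (Fin n) K}
    (h : MatSimilar P Q) : Q.rank = P.rank := by
  obtain ⟨A, rfl⟩ := h
  rw [Matrix.rank_mul_eq_left_of_isUnit_det _ _ ((Matrix.isUnit_iff_isUnit_det _).1 A⁻¹.isUnit),
    Matrix.rank_mul_eq_right_of_isUnit_det _ _ ((Matrix.isUnit_iff_isUnit_det _).1 A.isUnit)]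

theorem aux_rank_eq {K : Type*} [Field K] {n : ℕ} (P : Matrix (Fin n) (Fin n) K) :
    P.rank = Module.finrank K (LinearMap.range (Matrix.toLin' P)) := rfl

theorem aux_rank_add_le {K : Type*} [Field K] {n : ℕ} (A B : Matrix (Fin n) (Fin n) K) :
    (A + B).rank ≤ A.rank + B.rank := by
  rw [aux_rank_eq, aux_rank_eq, aux_rank_eq, map_add]
  refine le_trans (Submodule.finrank_mono ?_) (Submodule.finrank_add_le_finrank_add_finrank _ _)
  rintro _ ⟨x, rfl⟩
  exact Submodule.add_mem_sup ⟨x, rfl⟩ ⟨x, rfl⟩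

theorem aux_rank_neg {K : Type*} [Field K] {n : ℕ} (A : Matrix (Fin n) (Fin n) K) :
    (-A).rank = A.rank := by
  rw [aux_rank_eq, aux_rank_eq, map_neg, LinearMap.range_neg]

theorem aux_part2 {K : Type*} [Field K] {n : ℕ} (P P' : Matrix (Fin n) (Fin n) K)
    (h : P'.rank ≤ P.rank) : ∃ Q, MatSimilar P Q ∧ (Q + P').rank ≤ P.rank := by
  have d1 := LinearMap.finrank_range_add_finrank_ker (Matrix.toLin' P)
  have d2 := LinearMap.finrank_range_add_finrank_ker (Matrix.toLin' P')
  rw [← aux_rank_eq] at d1 d2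
  obtain ⟨g, hg⟩ := aux_exists_map_le (LinearMap.ker (Matrix.toLin' P))
    (LinearMap.ker (Matrix.toLin' P')) (by omega)
  refine ⟨_, aux_similar P g, ?_⟩
  rw [aux_rank_eq, map_add, Matrix.toLin'_toMatrix']
  set F := (g : (Fin n → K) →ₗ[K] (Fin n → K)) ∘ₗ Matrix.toLin' P ∘ₗ
      (g.symm : (Fin n → K) →ₗ[K] (Fin n → K)) with hF
  have d3 := LinearMap.finrank_range_add_finrank_ker (F + Matrix.toLin' P')
  have hle : LinearMap.ker F ≤ LinearMap.ker (F + Matrix.toLin' P') := by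
    intro x hx
    have h1 : F x = 0 := hx
    have h2 : Matrix.toLin' P' x = 0 := by
      rw [hF, aux_ker_conj] at hx
      obtain ⟨y, hy, rfl⟩ := hx
      exact hg y hy
    rw [LinearMap.mem_ker, LinearMap.add_apply, h1, h2, add_zero]
  have h3 := Submodule.finrank_mono hle
  have h4 : Module.finrank K (LinearMap.ker F)
      = Module.finrank K (LinearMap.ker (Matrix.toLin' P)) := by
    rw [hF, aux_ker_conj]
    exact LinearEquiv.finrank_map_eq g _
  omega

theorem aux_part1 {K : Type*} [Field K] {n : ℕ} (P P' : Matrix (Fin n) (Fin n) K)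
    (h : P.rank + P'.rank ≤ n) :
    ∃ Q', MatSimilar P' Q' ∧ (P + Q').rank = P.rank + P'.rank := by
  have d1 := LinearMap.finrank_range_add_finrank_ker (Matrix.toLin' P)
  have d2 := LinearMap.finrank_range_add_finrank_ker (Matrix.toLin' P')
  rw [← aux_rank_eq] at d1 d2
  have dn : Module.finrank K (Fin n → K) = n := by simp
  obtain ⟨C, hC⟩ := Submodule.exists_isCompl (LinearMap.ker (Matrix.toLin' P))
  have d3 := Submodule.finrank_add_eq_of_isCompl hC
  obtain ⟨g, hg⟩ := aux_exists_map_le C (LinearMap.ker (Matrix.toLin' P')) (by omega)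
  have h0 : LinearMap.ker (Matrix.toLin' P) ⊔ (LinearMap.ker (Matrix.toLin' P')).map
      (g.symm : (Fin n → K) →ₗ[K] (Fin n → K)) = ⊤ := by
    rw [eq_top_iff, ← hC.sup_eq_top]
    refine sup_le_sup le_rfl (fun x hx => ⟨g x, hg x hx, by simp⟩)
  obtain ⟨e, he1, he2⟩ := aux_general_position (LinearMap.range (Matrix.toLin' P)) _
    (LinearMap.range (Matrix.toLin' P')) _ (by rw [← aux_rank_eq, ← aux_rank_eq, dn]; exact h)
    _ g.symm h0 rfl
  refine ⟨_, aux_similar P' e, ?_⟩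
  have hs := aux_similar_rank (aux_similar P' e)
  set F := (e : (Fin n → K) →ₗ[K] (Fin n → K)) ∘ₗ Matrix.toLin' P' ∘ₗ
      (e.symm : (Fin n → K) →ₗ[K] (Fin n → K)) with hF
  rw [← hs, aux_rank_eq (P + _), aux_rank_eq P, aux_rank_eq (LinearMap.toMatrix' F),
    map_add, Matrix.toLin'_toMatrix']
  refine aux_rank_add (Matrix.toLin' P) F ?_ ?_
  · rw [hF, aux_ker_conj, he1]
  · rw [hF, aux_range_conj, he2]

/-- For `n × n` matrices `P, P'` with `rk(P), rk(P') ≤ n/2 - 1`: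
(0) for all `Q ∼ P`, `Q' ∼ P'`, `rk(Q + Q') ≥ |rk(P) - rk(P')|`;
(1) there are `Q ∼ P`, `Q' ∼ P'` with `rk(Q + Q') = rk(P) + rk(P')`;
(2) there are `Q ∼ P`, `Q' ∼ P'` with `rk(Q + Q') ≤ max(rk(P), rk(P'))`. -/
theorem rank_sum_of_similar {K : Type*} [Field K] (n : ℕ)
    (P P' : Matrix (Fin n) (Fin n) K)
    (hP : 2 * (P.rank + 1) ≤ n) (hP' : 2 * (P'.rank + 1) ≤ n) :
    (∀ Q Q', MatSimilar P Q → MatSimilar P' Q' →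
        ((P.rank : ℤ) - (P'.rank : ℤ)).natAbs ≤ (Q + Q').rank) ∧
    (∃ Q Q', MatSimilar P Q ∧ MatSimilar P' Q' ∧
        (Q + Q').rank = P.rank + P'.rank) ∧
    (∃ Q Q', MatSimilar P Q ∧ MatSimilar P' Q' ∧
        (Q + Q').rank ≤ max P.rank P'.rank) := by
  refine ⟨fun Q Q' hQ hQ' => ?_, ?_, ?_⟩
  · have h1 := aux_rank_add_le (Q + Q') (-Q')
    have h2 := aux_rank_add_le (Q + Q') (-Q)
    rw [add_neg_cancel_right, aux_rank_neg] at h1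
    rw [add_comm Q Q', add_neg_cancel_right, aux_rank_neg, add_comm Q' Q] at h2
    rw [aux_similar_rank hQ, aux_similar_rank hQ'] at h1 h2
    omega
  · obtain ⟨Q', hQ', h⟩ := aux_part1 P P' (by omega)
    exact ⟨P, Q', aux_similar_refl P, hQ', h⟩
  · rcases le_total P'.rank P.rank with h | h
    · obtain ⟨Q, hQ, hr⟩ := aux_part2 P P' h
      exact ⟨Q, P', hQ, aux_similar_refl P', hr.trans (le_max_left _ _)⟩
    · obtain ⟨Q, hQ, hr⟩ := aux_part2 P' P h
      refine ⟨P, Q, aux_similar_refl P, hQ, ?_⟩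
      rw [add_comm]
      exact hr.trans (le_max_right _ _)
end

section
/- Let K be an infinite field and let P ∈ gl_∞ (the inverse limit of n×n matrix spaces under corner projections) satisfy rk(P) = k < ∞. Then the closure of the SL_∞-orbit of P (under conjugation) equals {Q ∈ gl_∞ : rk(Q) ≤ k}. More precisely, for every n > k such that rk(pr_{2n}(P)) = k, the projection to gl_n of the SL_∞-orbit of P contains all n×n matrices of rank at most k. -/
open scoped ENat

/-- The extension of an `m × m` matrix to an `ℕ × ℕ` matrix, by the identity. -/
noncomputable def extMat {K : Type*} [Field K] (m : ℕ)
    (A : Matrix (Fin m) (Fin m) K) : ℕ → ℕ → K :=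
  fun i j =>
    if hi : i < m then (if hj : j < m then A ⟨i, hi⟩ ⟨j, hj⟩ else 0)
    else (if i = j then 1 else 0)

/-- Conjugation of an `ℕ × ℕ` matrix `P` by `Diag(A, I_∞)` for `A` an `m × m` matrix. -/
noncomputable def conjInf {K : Type*} [Field K] (m : ℕ)
    (A : Matrix (Fin m) (Fin m) K) (P : ℕ → ℕ → K) : ℕ → ℕ → K :=
  fun i j =>
    ∑ s ∈ Finset.range (max m (i + 1)), ∑ t ∈ Finset.range (max m (j + 1)),
      extMat m A i s * P s t * extMat m A⁻¹ t j

/-- The `SL_∞`-orbit of `P ∈ gl_∞` under conjugation: `SL_∞` is the union of the `SL_m`,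
each `SL_m` acting by conjugation by `Diag(A, I_∞)`. -/
noncomputable def slInfOrbit {K : Type*} [Field K] (P : ℕ → ℕ → K) :
    Set (ℕ → ℕ → K) :=
  {P' | ∃ (m : ℕ) (A : Matrix (Fin m) (Fin m) K), A.det = 1 ∧ P' = conjInf m A P}

/-- Zariski-closed subsets of the space of `n × n` matrices. -/
def MZClosed {K : Type*} [Field K] {n : ℕ} (S : Set (Matrix (Fin n) (Fin n) K)) : Prop :=
  ∃ T : Set (MvPolynomial (Fin n × Fin n) K),
    S = {M | ∀ f ∈ T, MvPolynomial.eval (fun p => M p.1 p.2) f = 0}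

/-- The Zariski closure of a set of `n × n` matrices. -/
def mzclosure {K : Type*} [Field K] {n : ℕ} (S : Set (Matrix (Fin n) (Fin n) K)) :
    Set (Matrix (Fin n) (Fin n) K) :=
  ⋂₀ {C | MZClosed C ∧ S ⊆ C}

section
open Module

theorem sl_exists_surj {K U N : Type*} [Field K] [AddCommGroup U] [Module K U] [AddCommGroup N]
    [Module K N] [FiniteDimensional K U] [FiniteDimensional K N]
    (h : finrank K U ≤ finrank K N) : ∃ f : N →ₗ[K] U, Function.Surjective f := by
  obtain ⟨i, hi⟩ : ∃ i : U →ₗ[K] N, Function.Injective i :=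
    ⟨(finBasis K U).constr ℕ (finBasis K N ∘ Fin.castLE h),
      (finBasis K U).injective_constr_of_linearIndependent
        ((finBasis K N).linearIndependent.comp _ (Fin.castLE_injective h))⟩
  obtain ⟨g, hg⟩ := i.exists_leftInverse_of_injective (LinearMap.ker_eq_bot.2 hi)
  exact ⟨g, fun u => ⟨i u, LinearMap.congr_fun hg u⟩⟩

theorem sl_exists_extend_surj {K N W : Type*} [Field K] [AddCommGroup W] [Module K W]
    [AddCommGroup N] [Module K N] [FiniteDimensional K W] [FiniteDimensional K N]
    (D : Submodule K N) (f : D →ₗ[K] W) (hf : Function.Injective f)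
    (h : finrank K W ≤ finrank K N) :
    ∃ F : N →ₗ[K] W, Function.Surjective F ∧ ∀ x : D, F x = f x := by
  obtain ⟨C, hC⟩ := Submodule.exists_isCompl D
  obtain ⟨C', hC'⟩ := Submodule.exists_isCompl (LinearMap.range f)
  have h1 := Submodule.finrank_add_eq_of_isCompl hC
  have h2 := Submodule.finrank_add_eq_of_isCompl hC'
  have h3 := LinearMap.finrank_range_of_inj hf
  obtain ⟨g, hg⟩ := sl_exists_surj (K := K) (U := C') (N := C) (by omega)
  refine ⟨LinearMap.ofIsCompl hC f (C'.subtype ∘ₗ g), ?_, fun x => by simp⟩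
  rw [← LinearMap.range_eq_top, LinearMap.range_ofIsCompl, LinearMap.range_comp,
    LinearMap.range_eq_top.2 hg, Submodule.map_top, Submodule.range_subtype, hC'.sup_eq_top]

theorem sl_exists_between {K W : Type*} [Field K] [AddCommGroup W]
    [Module K W] [FiniteDimensional K W] (S : Submodule K W) (k : ℕ) (h1 : finrank K S ≤ k)
    (h2 : k ≤ finrank K W) : ∃ R : Submodule K W, S ≤ R ∧ finrank K R = k := by
  induction k, h1 using Nat.le_induction with
  | base => exact ⟨S, le_rfl, rfl⟩
  | succ k hk ih =>
    obtain ⟨R, hR, hRk⟩ := ih (by omega)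
    have : R < ⊤ := by
      rw [lt_top_iff_ne_top]; rintro rfl; rw [finrank_top] at hRk; omega
    obtain ⟨x, -, hx⟩ := SetLike.exists_of_lt this
    refine ⟨R ⊔ Submodule.span K {x}, hR.trans le_sup_left, ?_⟩
    have hx0 : x ≠ 0 := by rintro rfl; exact hx R.zero_mem
    have h3 := Submodule.finrank_sup_add_finrank_inf_eq R (Submodule.span K {x})
    have h4 : R ⊓ Submodule.span K {x} = ⊥ := by
      rw [← disjoint_iff]; exact ((Submodule.disjoint_span_singleton' hx0).2 hx)
    rw [h4, finrank_bot, finrank_span_singleton hx0] at h3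
    omega

theorem sl_key {K V W : Type*} [Field K] [AddCommGroup W] [Module K W]
    [AddCommGroup V] [Module K V] [FiniteDimensional K W] [FiniteDimensional K V]
    (k : ℕ) (M : V →ₗ[K] V) (Q : W →ₗ[K] W) (hM : finrank K (LinearMap.range M) = k)
    (hQ : finrank K (LinearMap.range Q) ≤ k) (hk : k ≤ finrank K W)
    (hV : finrank K W + k ≤ finrank K V) :
    ∃ (F : V →ₗ[K] W) (E : W →ₗ[K] V), (∀ w, F (E w) = w) ∧ ∀ w, F (M (E w)) = Q w := by
  obtain ⟨R, hQR, hR⟩ := sl_exists_between _ k hQ hk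
  let e : LinearMap.range M ≃ₗ[K] R := LinearEquiv.ofFinrankEq _ _ (by rw [hM, hR])
  let X : LinearMap.range M →ₗ[K] W := R.subtype ∘ₗ e.toLinearMap
  have hX : Function.Injective X := R.injective_subtype.comp e.injective
  have hN := LinearMap.finrank_range_add_finrank_ker M
  let N := LinearMap.ker M
  let D : Submodule K N := (LinearMap.range M).comap N.subtype
  let j : D →ₗ[K] LinearMap.range M := LinearMap.codRestrict _ (N.subtype ∘ₗ D.subtype) (fun x => x.2)
  have hj : Function.Injective j := by
    intro a b hab
    apply Subtype.ext; apply Subtype.ext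
    exact congrArg (fun z : LinearMap.range M => (z : V)) hab
  obtain ⟨G, hG, hGD⟩ := sl_exists_extend_surj D (X ∘ₗ j) (hX.comp hj)
    (show finrank K W ≤ finrank K (LinearMap.ker M) by omega)
  let p1 : V →ₗ.[K] W := ⟨LinearMap.range M, X⟩
  let p2 : V →ₗ.[K] W := ⟨N, G⟩
  have hp : ∀ (x : p1.domain) (y : p2.domain), (x : V) = y → p1 x = p2 y := by
    rintro x y hxy
    have hy : y ∈ D := by change (y : V) ∈ LinearMap.range M; rw [← hxy]; exact x.2
    have := hGD ⟨y, hy⟩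
    change X x = G y
    rw [show G y = _ from this]
    change X x = X _
    congr 1
    exact Subtype.ext hxy
  obtain ⟨F, hF⟩ := LinearMap.exists_extend (p1.sup p2 hp).toFun
  have hF' : ∀ z : (p1.sup p2 hp).domain, F z = (p1.sup p2 hp) z := fun z => LinearMap.congr_fun hF z
  have hF1 : ∀ x : LinearMap.range M, F x = X x := fun x => by
    have h := LinearPMap.left_le_sup p1 p2 hp
    rw [show X x = p1 x from rfl, h.2 (x := x) (y := ⟨x, h.1 x.2⟩) rfl]
    exact hF' ⟨x, h.1 x.2⟩
  have hF2 : ∀ x : N, F x = G x := fun x => by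
    have h := LinearPMap.right_le_sup p1 p2 hp
    rw [show G x = p2 x from rfl, h.2 (x := x) (y := ⟨x, h.1 x.2⟩) rfl]
    exact hF' ⟨x, h.1 x.2⟩
  obtain ⟨g, hg⟩ := LinearMap.exists_rightInverse_of_surjective M.rangeRestrict M.range_rangeRestrict
  obtain ⟨h, hh⟩ := LinearMap.exists_rightInverse_of_surjective G (LinearMap.range_eq_top.2 hG)
  let Q' : W →ₗ[K] R := Q.codRestrict R (fun w => hQR ⟨w, rfl⟩)
  let E0 : W →ₗ[K] V := g ∘ₗ e.symm.toLinearMap ∘ₗ Q'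
  let E : W →ₗ[K] V := E0 + N.subtype ∘ₗ h ∘ₗ (LinearMap.id - F ∘ₗ E0)
  refine ⟨F, E, fun w => ?_, fun w => ?_⟩
  · have h1 : F (h (w - F (E0 w))) = w - F (E0 w) := by
      rw [hF2]; exact LinearMap.congr_fun hh _
    change F (E0 w + h (w - F (E0 w))) = w
    rw [map_add, h1]; abel
  · have h1 : M (E w) = M (E0 w) := by
      change M (E0 w + h (w - F (E0 w))) = _
      rw [map_add, LinearMap.mem_ker.1 (h _).2, add_zero]
    have h2 : M (E0 w) = (e.symm (Q' w) : LinearMap.range M) :=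
      congrArg Subtype.val (LinearMap.congr_fun hg (e.symm (Q' w)))
    rw [h1, h2, hF1]
    simp [X, Q']

theorem sl_key_equiv {K : Type*} [Field K] (n k : ℕ) (hk : k < n)
    (M : Matrix (Fin (2*n)) (Fin (2*n)) K) (Q : Matrix (Fin n) (Fin n) K)
    (hM : M.rank = k) (hQ : Q.rank ≤ k) :
    ∃ A : Matrix (Fin (2*n)) (Fin (2*n)) K, IsUnit A.det ∧
      (A * M * A⁻¹).submatrix (Fin.castLE (by omega)) (Fin.castLE (by omega)) = Q := by
  obtain ⟨F, E, hFE, hFME⟩ := sl_key k M.mulVecLin Q.mulVecLin hM hQ (by simp; omega)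
    (by simp; omega)
  have hFs : Function.Surjective F := fun w => ⟨E w, hFE w⟩
  have hr := LinearMap.finrank_range_add_finrank_ker F
  rw [LinearMap.range_eq_top.2 hFs, finrank_top] at hr
  simp at hr
  let c : LinearMap.ker F ≃ₗ[K] (Fin n → K) := LinearEquiv.ofFinrankEq _ _ (by simp; omega)
  let pr : (Fin (2*n) → K) →ₗ[K] LinearMap.ker F :=
    LinearMap.codRestrict _ (LinearMap.id - E ∘ₗ F) (fun v => by simp [hFE])
  let s : Fin n ⊕ Fin n ≃ Fin (2*n) := finSumFinEquiv.trans (finCongr (by omega))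
  let Φ : ((Fin n → K) × (Fin n → K)) ≃ₗ[K] (Fin (2*n) → K) :=
    (LinearEquiv.sumArrowLequivProdArrow (Fin n) (Fin n) K K).symm.trans
      (LinearEquiv.funCongrLeft K K s.symm)
  let a : (Fin (2*n) → K) →ₗ[K] (Fin (2*n) → K) := Φ.toLinearMap ∘ₗ (F.prod (c.toLinearMap ∘ₗ pr))
  let b : (Fin (2*n) → K) →ₗ[K] (Fin (2*n) → K) :=
    (E.coprod ((LinearMap.ker F).subtype ∘ₗ c.symm.toLinearMap)) ∘ₗ Φ.symm.toLinearMap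
  have hba : b ∘ₗ a = LinearMap.id := by
    apply LinearMap.ext; intro v
    simp [a, b, pr]
  have hBA : LinearMap.toMatrix' b * LinearMap.toMatrix' a = 1 := by
    rw [← LinearMap.toMatrix'_comp, hba, LinearMap.toMatrix'_id]
  have hAB := mul_eq_one_comm.1 hBA
  refine ⟨LinearMap.toMatrix' a, Matrix.isUnit_det_of_left_inverse hBA, ?_⟩
  rw [Matrix.inv_eq_left_inv hBA]
  have hs : ∀ i : Fin n, s.symm (Fin.castLE (by omega) i) = Sum.inl i := by
    intro i; rw [Equiv.symm_apply_eq]; ext; simp [s]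
  have hs' : ∀ i : Fin n, s (Sum.inl i) = Fin.castLE (by omega) i := by
    intro i; ext; simp [s]
  have hbe : ∀ j : Fin n, b (Pi.single (Fin.castLE (by omega) j) 1) = E (Pi.single j 1) := by
    intro j
    have : (Pi.single (Fin.castLE (by omega) j) 1 : Fin (2*n) → K) = Φ (Pi.single j 1, 0) := by
      rw [← hs' j]
      ext x
      obtain ⟨x, rfl⟩ := s.surjective x
      rcases x with x | x <;> simp [Φ, LinearEquiv.funCongrLeft, LinearMap.funLeft, Pi.single_apply, LinearEquiv.sumArrowLequivProdArrow]
    simp [b, this]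
  have hae : ∀ v (i : Fin n), a v (Fin.castLE (by omega) i) = F v i := by
    intro v i
    simp [a, Φ, LinearEquiv.funCongrLeft, LinearMap.funLeft, hs]
  have hMM : M = LinearMap.toMatrix' M.mulVecLin := by
    rw [← Matrix.toLin'_apply', LinearMap.toMatrix'_toLin']
  ext i j
  rw [hMM, ← LinearMap.toMatrix'_comp, ← LinearMap.toMatrix'_comp, Matrix.submatrix_apply,
    LinearMap.toMatrix'_apply]
  simp only [LinearMap.comp_apply, hbe, hae, hFME]
  simp

theorem sl_key_sl {K : Type*} [Field K] (n k : ℕ) (hk : k < n)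
    (M : Matrix (Fin (2*n)) (Fin (2*n)) K) (Q : Matrix (Fin n) (Fin n) K)
    (hM : M.rank = k) (hQ : Q.rank ≤ k) :
    ∃ A : Matrix (Fin (2*n)) (Fin (2*n)) K, A.det = 1 ∧
      (A * M * A⁻¹).submatrix (Fin.castLE (by omega)) (Fin.castLE (by omega)) = Q := by
  obtain ⟨A, hA, hAQ⟩ := sl_key_equiv n k hk M Q hM hQ
  let l : Fin (2*n) := ⟨2*n-1, by omega⟩
  let d : Fin (2*n) → K := Function.update 1 l (A.det)⁻¹
  let d' : Fin (2*n) → K := Function.update 1 l A.det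
  have hdd : Matrix.diagonal d' * Matrix.diagonal d = 1 := by
    rw [Matrix.diagonal_mul_diagonal, ← Matrix.diagonal_one]
    congr 1; ext i
    by_cases h : i = l
    · subst h; simp [d, d', hA.ne_zero]
    · simp [d, d', h]
  have hd : ∀ i : Fin n, d (Fin.castLE (by omega) i) = 1 := by
    intro i
    have : (Fin.castLE (by omega) i : Fin (2*n)) ≠ l := by
      intro h; have := congrArg Fin.val h; simp [l] at this; omega
    simp [d, this]
  have hd' : ∀ i : Fin n, d' (Fin.castLE (by omega) i) = 1 := by
    intro i
    have : (Fin.castLE (by omega) i : Fin (2*n)) ≠ l := by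
      intro h; have := congrArg Fin.val h; simp [l] at this; omega
    simp [d', this]
  refine ⟨Matrix.diagonal d * A, ?_, ?_⟩
  · rw [Matrix.det_mul, Matrix.det_diagonal, Finset.prod_update_of_mem (Finset.mem_univ _)]
    simp [hA.ne_zero]
  · rw [Matrix.mul_inv_rev, Matrix.inv_eq_left_inv hdd]
    rw [← hAQ]
    ext i j
    have : Matrix.diagonal d * A * M * (A⁻¹ * Matrix.diagonal d') =
      Matrix.diagonal d * (A * M * A⁻¹) * Matrix.diagonal d' := by simp only [Matrix.mul_assoc]
    rw [this, Matrix.submatrix_apply, Matrix.mul_diagonal, Matrix.diagonal_mul, hd, hd']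
    simp

theorem sl_exists_minor {K : Type*} [Field K] {n : ℕ} (M : Matrix (Fin n) (Fin n) K) :
    ∃ r c : Fin M.rank → Fin n, (M.submatrix r c).det ≠ 0 := by
  have rows : ∀ {m l : ℕ} (N : Matrix (Fin m) (Fin l) K) (s : ℕ), N.rank = s →
      ∃ r : Fin s → Fin m, LinearIndependent K (N.submatrix r id).row := by
    intro m l N s hs
    rw [Matrix.rank_eq_finrank_span_row] at hs
    subst hs
    obtain ⟨f, hf, -, hl⟩ := Submodule.exists_fun_fin_finrank_span_eq K (Set.range N.row)
    choose r hr using hf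
    refine ⟨r, ?_⟩
    have hf : f = (N.submatrix r id).row := by
      ext i j
      rw [← hr i]; rfl
    rw [← hf]
    exact hl
  obtain ⟨r, hr⟩ := rows M M.rank rfl
  have h1 := hr.rank_matrix
  rw [← Matrix.rank_transpose, Fintype.card_fin] at h1
  obtain ⟨c, hc⟩ := rows _ _ h1
  refine ⟨r, c, ?_⟩
  have h2 := (Matrix.linearIndependent_rows_iff_isUnit.1 hc)
  rw [Matrix.isUnit_iff_isUnit_det] at h2
  rw [← Matrix.det_transpose]
  exact h2.ne_zero

theorem sl_rank_closed {K : Type*} [Field K] (n k : ℕ) :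
    MZClosed {M : Matrix (Fin n) (Fin n) K | M.rank ≤ k} := by
  refine ⟨{f | ∃ (s : ℕ) (_ : k < s) (r c : Fin s → Fin n),
    f = (Matrix.of fun i j => (MvPolynomial.X (r i, c j) : MvPolynomial (Fin n × Fin n) K)).det}, ?_⟩
  have ev : ∀ (M : Matrix (Fin n) (Fin n) K) (s : ℕ) (r c : Fin s → Fin n),
      MvPolynomial.eval (fun p => M p.1 p.2)
        (Matrix.of fun i j => (MvPolynomial.X (r i, c j) : MvPolynomial (Fin n × Fin n) K)).det
        = (M.submatrix r c).det := by
    intro M s r c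
    rw [RingHom.map_det]
    congr 1
    ext i j
    simp
  ext M
  simp only [Set.mem_setOf_eq]
  constructor
  · rintro hM f ⟨s, hs, r, c, rfl⟩
    rw [ev]
    by_contra h
    have h1 := Matrix.rank_of_det_ne_zero h
    have h2 := M.rank_submatrix_le r c
    simp at h1
    omega
  · intro h
    by_contra! hk
    obtain ⟨r, c, hrc⟩ := sl_exists_minor M
    exact hrc (by rw [← ev]; exact h _ ⟨_, hk, r, c, rfl⟩)

theorem sl_corner_le {K : Type*} [Field K] {n N : ℕ} (h : n ≤ N) (P : ℕ → ℕ → K) :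
    glInfCorner n P = (glInfCorner N P).submatrix (Fin.castLE h) (Fin.castLE h) := rfl

theorem sl_corner_conj {K : Type*} [Field K] {m N : ℕ} (h : m ≤ N)
    (A : Matrix (Fin m) (Fin m) K) (P : ℕ → ℕ → K) :
    glInfCorner N (conjInf m A P) =
      glInfCorner N (extMat m A) * glInfCorner N P * glInfCorner N (extMat m A⁻¹) := by
  ext i j
  rw [Matrix.mul_assoc]
  simp only [Matrix.mul_apply, glInfCorner, Matrix.of_apply, conjInf]
  rw [Fin.sum_univ_eq_sum_range (fun s => extMat m A i s *
    ∑ t : Fin N, P s t * extMat m A⁻¹ t j) N]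
  have hi := i.2
  have hj := j.2
  rw [Finset.sum_subset (s₂ := Finset.range N)]
  · refine Finset.sum_congr rfl fun s _ => ?_
    rw [Fin.sum_univ_eq_sum_range (fun t => P s t * extMat m A⁻¹ t j) N, Finset.mul_sum]
    rw [Finset.sum_subset (s₂ := Finset.range N)]
    · simp only [mul_assoc]
    · intro x; simp only [Finset.mem_range]; omega
    · intro t _ ht
      simp only [Finset.mem_range, not_lt] at ht
      have : extMat m A⁻¹ t j = 0 := by
        unfold extMat
        rw [dif_neg (by omega), if_neg (by omega)]
      rw [this, mul_zero]
  · intro x; simp only [Finset.mem_range]; omega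
  · intro s _ hs
    simp only [Finset.mem_range, not_lt] at hs
    have : extMat m A i s = 0 := by
      unfold extMat
      split_ifs <;> first | rfl | omega
    simp [this]

theorem sl_corner_ext {K : Type*} [Field K] {m : ℕ} (A : Matrix (Fin m) (Fin m) K) :
    glInfCorner m (extMat m A) = A := by
  ext i j
  simp [glInfCorner, extMat]

theorem sl_corner_rank_le {K : Type*} [Field K] {P : ℕ → ℕ → K} {k : ℕ}
    (hP : glInfRank P ≤ (k : ℕ∞)) (n : ℕ) : (glInfCorner n P).rank ≤ k := by
  have := (le_iSup (fun n : ℕ => ((glInfCorner n P).rank : ℕ∞)) n).trans hP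
  exact_mod_cast this

theorem sl_part2 {K : Type*} [Field K] (P : ℕ → ℕ → K) (k n : ℕ) (hk : k < n)
    (hr : (glInfCorner (2 * n) P).rank = k) :
    {Q : Matrix (Fin n) (Fin n) K | Q.rank ≤ k} ⊆ glInfCorner n '' slInfOrbit P := by
  intro Q hQ
  obtain ⟨A, hA, hAQ⟩ := sl_key_sl n k hk _ Q hr hQ
  refine ⟨conjInf (2 * n) A P, ⟨_, A, hA, rfl⟩, ?_⟩
  rw [sl_corner_le (show n ≤ 2 * n by omega), sl_corner_conj le_rfl, sl_corner_ext, sl_corner_ext,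
    hAQ]

end

/-- If `P ∈ gl_∞` has `rk(P) = k < ∞`, then the closure of the `SL_∞`-orbit of `P`
(an element `Q` lies in the closure iff each of its corners lies in the Zariski closure
of the corresponding projection of the orbit) is `{Q : rk(Q) ≤ k}`. More precisely, for
every `n > k` with `rk(pr_{2n}(P)) = k`, the projection to `gl_n` of the `SL_∞`-orbit of
`P` contains all `n × n` matrices of rank at most `k`. -/
theorem slInf_orbit_closure_eq_rank_le {K : Type*} [Field K] [Infinite K]
    (P : ℕ → ℕ → K) (k : ℕ) (hP : glInfRank P = (k : ℕ∞)) :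
    ({Q : ℕ → ℕ → K |
        ∀ n : ℕ, glInfCorner n Q ∈ mzclosure (glInfCorner n '' slInfOrbit P)}
      = {Q | glInfRank Q ≤ (k : ℕ∞)}) ∧
    (∀ n : ℕ, k < n → (glInfCorner (2 * n) P).rank = k →
      {Q : Matrix (Fin n) (Fin n) K | Q.rank ≤ k} ⊆ glInfCorner n '' slInfOrbit P) := by
  refine ⟨?_, fun n hk hr => sl_part2 P k n hk hr⟩
  ext Q
  simp only [Set.mem_setOf_eq]
  constructor
  · intro h
    refine iSup_le fun n => ?_
    have := Set.mem_sInter.1 (h n) {M | M.rank ≤ k} ⟨sl_rank_closed n k, ?_⟩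
    · exact_mod_cast this
    · rintro _ ⟨_, ⟨m, A, -, rfl⟩, rfl⟩
      have h1 : (glInfCorner (max m n) (conjInf m A P)).rank ≤ k := by
        rw [sl_corner_conj (le_max_left m n)]
        exact (Matrix.rank_mul_le_left _ _).trans
          ((Matrix.rank_mul_le_right _ _).trans (sl_corner_rank_le hP.le _))
      rw [Set.mem_setOf_eq, sl_corner_le (le_max_right m n)]
      exact (Matrix.rank_submatrix_le _ _ _).trans h1
  · intro hQ n
    obtain ⟨N0, hN0⟩ := ENat.exists_eq_iSup_of_lt_top
      (f := fun n : ℕ => ((glInfCorner n P).rank : ℕ∞))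
      (by change glInfRank P < ⊤; rw [hP]; exact ENat.coe_lt_top k)
    have hN0' : (glInfCorner N0 P).rank = k := by
      have : ((glInfCorner N0 P).rank : ℕ∞) = k := hN0.trans hP
      exact_mod_cast this
    obtain ⟨N, h1, h2, h3⟩ : ∃ N, n ≤ N ∧ k < N ∧ N0 ≤ 2 * N :=
      ⟨n + k + 1 + N0, by omega, by omega, by omega⟩
    have hr : (glInfCorner (2 * N) P).rank = k := by
      refine le_antisymm (sl_corner_rank_le hP.le _) ?_
      rw [← hN0', sl_corner_le h3]
      exact Matrix.rank_submatrix_le _ _ _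
    obtain ⟨R, hR, hRQ⟩ := sl_part2 P k N h2 hr (sl_corner_rank_le hQ N)
    refine Set.mem_sInter.2 fun C hC => hC.2 ⟨R, hR, ?_⟩
    rw [sl_corner_le h1, hRQ, ← sl_corner_le h1]
end

section
/- Let K be an infinite field, n ∈ ℕ, and let Y be an SL_n-stable Zariski-closed subset of gl_n (under conjugation). Suppose the ideal I(Y) contains a non-zero polynomial f that depends only on the variables p_{kℓ} with k ∈ 𝒦, ℓ ∈ 𝒧 for some disjoint subsets 𝒦, 𝒧 ⊂ {1,...,n} of equal size m ≤ (n−1)/2. Then rk(P, I_n) < deg(f) for all P ∈ Y. -/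
open scoped ENat

section LinAlg
variable {K : Type*} [Field K] {V : Type*} [AddCommGroup V] [Module K V]

/-- The vectors `u i, T (u i)` are linearly independent. -/
def OffAdm (T : V →ₗ[K] V) {k : ℕ} (u : Fin k → V) : Prop :=
  ∀ a b : Fin k → K, (∑ i, a i • u i) + (∑ i, b i • T (u i)) = 0 → a = 0 ∧ b = 0

/-- The span of the vectors `u i, T (u i)`. -/
def offSpan (T : V →ₗ[K] V) {k : ℕ} (u : Fin k → V) : Submodule K V :=
  Submodule.span K (Set.range (Sum.elim u (fun i => T (u i))))

theorem OffAdm.linInd {T : V →ₗ[K] V} {k : ℕ} {u : Fin k → V} (h : OffAdm T u) :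
    LinearIndependent K (Sum.elim u (fun i => T (u i))) := by
  rw [Fintype.linearIndependent_iff]
  intro g hg
  rw [Fintype.sum_sum_type] at hg
  obtain ⟨h1, h2⟩ := h (fun i => g (Sum.inl i)) (fun i => g (Sum.inr i)) (by simpa using hg)
  rintro (i | i)
  · exact congrFun h1 i
  · exact congrFun h2 i

theorem mem_offSpan {T : V →ₗ[K] V} {k : ℕ} {u : Fin k → V} {y : V} :
    y ∈ offSpan T u ↔ ∃ a b : Fin k → K, (∑ i, a i • u i) + (∑ i, b i • T (u i)) = y := by
  unfold offSpan
  rw [Submodule.mem_span_range_iff_exists_fun]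
  constructor
  · rintro ⟨c, hc⟩
    rw [Fintype.sum_sum_type] at hc
    exact ⟨fun i => c (Sum.inl i), fun i => c (Sum.inr i), by simpa using hc⟩
  · rintro ⟨a, b, h⟩
    refine ⟨Sum.elim a b, ?_⟩
    rw [Fintype.sum_sum_type]
    simpa using h

theorem finrank_offSpan_le (T : V →ₗ[K] V) {k : ℕ} (u : Fin k → V) :
    Module.finrank K (offSpan T u) ≤ 2 * k := by
  have := finrank_range_le_card (R := K) (Sum.elim u (fun i => T (u i)))
  simp only [Set.finrank, Fintype.card_sum, Fintype.card_fin] at this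
  unfold offSpan
  omega

theorem OffAdm.finrank {T : V →ₗ[K] V} {k : ℕ} {u : Fin k → V} (h : OffAdm T u) :
    Module.finrank K (offSpan T u) = 2 * k := by
  unfold offSpan
  rw [finrank_span_eq_card h.linInd]
  simp; omega

theorem left_mem_offSpan (T : V →ₗ[K] V) {k : ℕ} (u : Fin k → V) (i : Fin k) :
    u i ∈ offSpan T u := Submodule.subset_span ⟨Sum.inl i, rfl⟩

theorem right_mem_offSpan (T : V →ₗ[K] V) {k : ℕ} (u : Fin k → V) (i : Fin k) :
    T (u i) ∈ offSpan T u := Submodule.subset_span ⟨Sum.inr i, rfl⟩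

theorem OffAdm.sub_smul {T : V →ₗ[K] V} {k : ℕ} {u : Fin k → V} (h : OffAdm T u) (c : K) :
    OffAdm (T - c • LinearMap.id) u := by
  intro a b hab
  obtain ⟨h1, h2⟩ := h (fun i => a i - c * b i) b (by
    rw [← hab, ← Finset.sum_add_distrib, ← Finset.sum_add_distrib]
    refine Finset.sum_congr rfl fun i _ => ?_
    simp only [LinearMap.sub_apply, LinearMap.smul_apply, LinearMap.id_apply]
    module)
  refine ⟨?_, h2⟩
  funext i
  have := congrFun h1 i
  simpa [h2] using this

variable [FiniteDimensional K V]

theorem off_exists_scalar (T : V →ₗ[K] V) {k : ℕ} (hk : 2 * k + 2 ≤ Module.finrank K V)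
    (hmax : ∀ u : Fin (k + 1) → V, ¬ OffAdm T u) (u : Fin k → V) (hu : OffAdm T u) :
    ∃ c : K, ∀ v, T v - c • v ∈ offSpan T u := by
  set W := offSpan T u with hW
  have hq : Module.finrank K (V ⧸ W) + Module.finrank K W = Module.finrank K V :=
    Submodule.finrank_quotient_add_finrank W
  have hle := finrank_offSpan_le T u
  rw [← hW] at hle
  have key : ∀ v, W.mkQ v ≠ 0 → ∃ c : K, W.mkQ (T v) = c • W.mkQ v := by
    intro v hv
    by_contra hcon
    push Not at hcon
    apply hmax (Fin.cons v u)
    intro a b hab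
    simp only [Fin.sum_univ_succ, Fin.cons_zero, Fin.cons_succ] at hab
    have hm : (∑ i : Fin k, a i.succ • u i) + (∑ i : Fin k, b i.succ • T (u i)) ∈ W :=
      mem_offSpan.2 ⟨fun i => a i.succ, fun i => b i.succ, rfl⟩
    have h2 : a 0 • W.mkQ v + b 0 • W.mkQ (T v) = 0 := by
      rw [← map_smul, ← map_smul, ← map_add, Submodule.mkQ_apply, Submodule.Quotient.mk_eq_zero]
      have : a 0 • v + b 0 • T v =
        -((∑ i : Fin k, a i.succ • u i) + (∑ i : Fin k, b i.succ • T (u i))) := by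
        rw [eq_neg_iff_add_eq_zero, ← hab]; abel
      rw [this]; exact W.neg_mem hm
    have hb : b 0 = 0 := by
      by_contra hb
      apply hcon (-(b 0)⁻¹ * a 0)
      have : b 0 • W.mkQ (T v) = - (a 0 • W.mkQ v) := by
        rw [eq_neg_iff_add_eq_zero, ← h2]; abel
      rw [← inv_smul_smul₀ hb (W.mkQ (T v)), this]
      module
    have ha : a 0 = 0 := by
      rw [hb, zero_smul, add_zero] at h2
      exact (smul_eq_zero.1 h2).resolve_right hv
    rw [ha, hb] at hab
    obtain ⟨h3, h4⟩ := hu (fun i => a i.succ) (fun i => b i.succ) (by simpa using hab)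
    constructor
    · funext i; refine Fin.cases ha (fun j => congrFun h3 j) i
    · funext i; refine Fin.cases hb (fun j => congrFun h4 j) i
  -- two independent vectors in the quotient
  have hker : W ≤ LinearMap.ker (W.mkQ ∘ₗ T) := by
    intro w hw
    rw [LinearMap.mem_ker, LinearMap.comp_apply]
    by_contra hne
    -- pick q not in the line of `mkQ (T w)`
    have hlt : Submodule.span K {W.mkQ (T w)} < ⊤ := by
      refine lt_top_iff_ne_top.2 fun htop => ?_
      have h1 := finrank_span_singleton (K := K) hne
      rw [htop, finrank_top] at h1
      omega
    obtain ⟨q, -, hqn⟩ := SetLike.exists_of_lt hlt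
    obtain ⟨v, rfl⟩ := W.mkQ_surjective q
    have hv0 : W.mkQ v ≠ 0 := fun h => hqn (by rw [h]; exact zero_mem _)
    have hw0 : W.mkQ w = 0 := by simpa using hw
    obtain ⟨c, hc⟩ := key v hv0
    obtain ⟨d, hd⟩ := key (v + w) (by rwa [map_add, hw0, add_zero])
    rw [map_add, map_add, map_add, hw0, add_zero, hc] at hd
    have hd' : W.mkQ (T w) = (d - c) • W.mkQ v := by
      rw [sub_smul, ← hd]; abel
    have hdc : d - c ≠ 0 := fun h => hne (by rw [hd', h, zero_smul])
    apply hqn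
    rw [Submodule.mem_span_singleton]
    exact ⟨(d - c)⁻¹, by rw [hd', inv_smul_smul₀ hdc]⟩
  obtain ⟨c, hc⟩ := (W.liftQ (W.mkQ ∘ₗ T) hker).exists_eq_smul_id_of_forall_notLinearIndependent
    (by
      intro q
      obtain ⟨v, rfl⟩ := W.mkQ_surjective q
      by_cases hv : W.mkQ v = 0
      · rw [hv]; simp [linearIndependent_fin2]
      · rw [LinearIndependent.pair_iff' hv]
        obtain ⟨c, hc⟩ := key v hv
        push Not
        exact ⟨c, by rw [← hc]; rfl⟩)
  refine ⟨c, fun v => ?_⟩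
  have := LinearMap.congr_fun hc (W.mkQ v)
  rw [← Submodule.Quotient.mk_eq_zero, ← Submodule.mkQ_apply, map_sub, map_smul, sub_eq_zero]
  simpa using this

theorem off_rank_le_of_range [Infinite K] (T : V →ₗ[K] V) {k : ℕ}
    (hk : 2 * k + 2 ≤ Module.finrank K V)
    (hmax : ∀ u : Fin (k + 1) → V, ¬ OffAdm T u) (u : Fin k → V) (hu : OffAdm T u)
    (hT : ∀ v, T v ∈ offSpan T u) : Module.finrank K (LinearMap.range T) ≤ k := by
  by_contra hcon
  push Not at hcon
  obtain ⟨a, ha0, z, hz⟩ : ∃ a : Fin k → K, a ≠ 0 ∧ ∃ z, T z = ∑ i, a i • u i := by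
    have hnle : ¬ LinearMap.range T ≤ Submodule.span K (Set.range fun i => T (u i)) := by
      intro hle
      have h1 := Submodule.finrank_mono hle
      have h2 := finrank_range_le_card (R := K) (fun i => T (u i))
      simp only [Set.finrank, Fintype.card_fin] at h2
      omega
    obtain ⟨y, ⟨v, rfl⟩, hy⟩ := SetLike.not_le_iff_exists.1 hnle
    obtain ⟨a, b, hab⟩ := mem_offSpan.1 (hT v)
    refine ⟨a, ?_, v - ∑ i, b i • u i, ?_⟩
    · rintro rfl
      apply hy
      rw [← hab]
      simp only [Pi.zero_apply, zero_smul, Finset.sum_const_zero, zero_add]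
      exact Submodule.sum_mem _ fun i _ => Submodule.smul_mem _ _ (Submodule.subset_span ⟨i, rfl⟩)
    · rw [map_sub, ← hab, map_sum]; simp
  obtain ⟨j, hj⟩ := Function.ne_iff.1 ha0
  simp only [Pi.zero_apply] at hj
  have hle := finrank_offSpan_le T u
  obtain ⟨x, hx⟩ : ∃ x, x ∉ offSpan T u := by
    by_contra h
    push Not at h
    have : offSpan T u = ⊤ := by rw [eq_top_iff]; exact fun x _ => h x
    rw [this, finrank_top] at hle
    omega
  obtain ⟨α, β, hαβ⟩ := mem_offSpan.1 (hT x)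
  classical
  obtain ⟨t, ht⟩ : ∃ t : K, t ∉ ({0, -(β j)⁻¹} : Finset K) := Infinite.exists_notMem_finset _
  simp only [Finset.mem_insert, Finset.mem_singleton, not_or] at ht
  obtain ⟨ht0, ht1⟩ := ht
  have htβ : 1 + t * β j ≠ 0 := by
    intro h
    have hβ : β j ≠ 0 := by rintro h0; simp [h0] at h
    apply ht1
    field_simp
    linear_combination h
  set u' : Fin k → V := fun i => u i + (if i = j then t else 0) • x with hu'
  have hu'adm : OffAdm T u' := by
    intro p q hpq
    have e1 : ∑ i, p i • u' i = (∑ i, p i • u i) + (t * p j) • x := by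
      simp only [hu', smul_add, Finset.sum_add_distrib]
      congr 1
      rw [Finset.sum_eq_single j]
      · simp [smul_smul, mul_comm]
      · intro i _ hi; simp [hi]
      · simp
    have e2 : ∑ i, q i • T (u' i) = (∑ i, q i • T (u i)) + (t * q j) • T x := by
      simp only [hu', map_add, map_smul, smul_add, Finset.sum_add_distrib]
      congr 1
      rw [Finset.sum_eq_single j]
      · simp [smul_smul, mul_comm]
      · intro i _ hi; simp [hi]
      · simp
    rw [e1, e2] at hpq
    have hpj : p j = 0 := by
      by_contra hpj
      apply hx
      have hm : (∑ i, p i • u i) + (∑ i, q i • T (u i)) + (t * q j) • T x ∈ offSpan T u :=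
        add_mem (mem_offSpan.2 ⟨p, q, rfl⟩) (Submodule.smul_mem _ _ (hT x))
      have : (t * p j) • x = -((∑ i, p i • u i) + (∑ i, q i • T (u i)) + (t * q j) • T x) := by
        rw [eq_neg_iff_add_eq_zero, ← hpq]; abel
      have h3 : (t * p j) • x ∈ offSpan T u := by rw [this]; exact neg_mem hm
      exact (Submodule.smul_mem_iff _ (mul_ne_zero ht0 hpj)).1 h3
    rw [hpj, mul_zero, zero_smul, add_zero, ← hαβ] at hpq
    obtain ⟨h1, h2⟩ := hu (fun i => p i + t * q j * α i) (fun i => q i + t * q j * β i) (by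
      rw [← hpq]
      simp only [add_smul, Finset.sum_add_distrib, smul_add, Finset.smul_sum, smul_smul]
      abel)
    have hqj : q j = 0 := by
      have := congrFun h2 j
      simp only [Pi.zero_apply] at this
      have : q j * (1 + t * β j) = 0 := by linear_combination this
      exact (mul_eq_zero.1 this).resolve_right htβ
    constructor
    · funext i; simpa [hqj] using congrFun h1 i
    · funext i; simpa [hqj] using congrFun h2 i
  obtain ⟨c, hc⟩ := off_exists_scalar T hk hmax u' hu'adm
  have hu'n : ∀ i, i ≠ j → u' i = u i := fun i hi => by simp [hu', hi]
  have hu'j : u' j = u j + t • x := by simp [hu']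
  by_cases hc0 : c = 0
  · subst hc0
    simp only [zero_smul, sub_zero] at hc
    have hui : ∀ i, i ≠ j → u i ∈ offSpan T u' := fun i hi => by
      rw [← hu'n i hi]; exact left_mem_offSpan T u' i
    have huj : u j ∈ offSpan T u' := by
      have h1 := hc z
      rw [hz, ← Finset.add_sum_erase _ _ (Finset.mem_univ j)] at h1
      have h2 : ∑ i ∈ Finset.univ.erase j, a i • u i ∈ offSpan T u' :=
        Submodule.sum_mem _ fun i hi => Submodule.smul_mem _ _ (hui i (Finset.ne_of_mem_erase hi))
      exact (Submodule.smul_mem_iff _ hj).1 ((Submodule.add_mem_iff_left _ h2).1 h1)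
    have hxm : x ∈ offSpan T u' := by
      have h1 := left_mem_offSpan T u' j
      rw [hu'j] at h1
      exact (Submodule.smul_mem_iff _ ht0).1 ((Submodule.add_mem_iff_right _ huj).1 h1)
    have hlt : offSpan T u < offSpan T u' := by
      refine SetLike.lt_iff_le_and_exists.2 ⟨?_, x, hxm, hx⟩
      refine Submodule.span_le.2 ?_
      rintro _ ⟨i | i, rfl⟩
      · by_cases hi : i = j
        · subst hi; exact huj
        · exact hui i hi
      · exact hc _
    have := Submodule.finrank_lt_finrank_of_lt hlt
    rw [hu.finrank, hu'adm.finrank] at this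
    omega
  · have hsub : offSpan T u' ≤ offSpan T u ⊔ Submodule.span K {x} := by
      refine Submodule.span_le.2 ?_
      rintro _ ⟨i | i, rfl⟩
      · exact add_mem (Submodule.mem_sup_left (left_mem_offSpan T u i))
          (Submodule.mem_sup_right (Submodule.smul_mem _ _ (Submodule.mem_span_singleton_self x)))
      · exact Submodule.mem_sup_left (hT _)
    have htop : offSpan T u ⊔ Submodule.span K {x} = ⊤ := by
      rw [eq_top_iff]
      intro v _
      have : c • v = T v - (T v - c • v) := by abel
      refine (Submodule.smul_mem_iff _ hc0).1 ?_
      rw [this]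
      exact sub_mem (Submodule.mem_sup_left (hT v)) (hsub (hc v))
    have h1 := Submodule.finrank_add_le_finrank_add_finrank (offSpan T u) (Submodule.span K {x})
    rw [htop, finrank_top] at h1
    have h2 := finrank_span_le_card (R := K) ({x} : Set V)
    simp at h2
    omega

theorem off_exists_rank_le [Infinite K] (T : V →ₗ[K] V) {k : ℕ}
    (hk : 2 * k + 2 ≤ Module.finrank K V)
    (hmax : ∀ u : Fin (k + 1) → V, ¬ OffAdm T u) (u : Fin k → V) (hu : OffAdm T u) :
    ∃ c : K, Module.finrank K (LinearMap.range (T - c • LinearMap.id)) ≤ k := by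
  obtain ⟨c, hc⟩ := off_exists_scalar T hk hmax u hu
  refine ⟨c, off_rank_le_of_range _ hk (fun v hv => hmax v ?_) u (hu.sub_smul c) fun v => ?_⟩
  · have := hv.sub_smul (-c)
    simpa using this
  · have h1 : offSpan T u ≤ offSpan (T - c • LinearMap.id) u := by
      refine Submodule.span_le.2 ?_
      rintro _ ⟨i | i, rfl⟩
      · exact left_mem_offSpan _ u i
      · have : T (u i) = (T - c • (LinearMap.id : V →ₗ[K] V)) (u i) + c • u i := by simp
        simp only [Sum.elim_inr]
        rw [this]
        exact add_mem (right_mem_offSpan _ u i) (Submodule.smul_mem _ _ (left_mem_offSpan _ u i))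
    exact h1 (by simpa using hc v)

theorem off_exists_adm [Infinite K] (T : V →ₗ[K] V) (e : ℕ) (he : 2 * e ≤ Module.finrank K V)
    (hr : ∀ c : K, e ≤ Module.finrank K (LinearMap.range (T - c • LinearMap.id))) :
    ∀ k, k ≤ e → ∃ u : Fin k → V, OffAdm T u := by
  intro k
  induction k with
  | zero => exact fun _ => ⟨Fin.elim0, fun a b _ => ⟨Subsingleton.elim _ _, Subsingleton.elim _ _⟩⟩
  | succ k ih =>
    intro hke
    obtain ⟨u, hu⟩ := ih (by omega)
    by_contra hcon
    push Not at hcon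
    obtain ⟨c, hc⟩ := off_exists_rank_le T (by omega) hcon u hu
    have := hr c
    omega

end LinAlg

section MatPart
open Matrix
variable {K : Type*} [Field K]

theorem off_factor_fin {α β ι : Type*} [Fintype ι] {e : ℕ} (hι : Fintype.card ι ≤ e)
    (X : Matrix α ι K) (Y : Matrix ι β K) :
    ∃ (X' : Matrix α (Fin e) K) (Y' : Matrix (Fin e) β K), X * Y = X' * Y' := by
  classical
  obtain ⟨φ⟩ := Function.Embedding.nonempty_of_card_le (α := ι) (β := Fin e) (by simpa using hι)
  set J : Matrix ι (Fin e) K := (1 : Matrix (Fin e) (Fin e) K).submatrix φ id with hJ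
  have hJJ : J * Jᵀ = 1 := by
    ext i j
    simp [hJ, Matrix.mul_apply, Matrix.one_apply, φ.injective.eq_iff]
  refine ⟨X * J, Jᵀ * Y, ?_⟩
  rw [Matrix.mul_assoc, ← Matrix.mul_assoc J, hJJ, Matrix.one_mul]

/-- Extend a square matrix indexed by `s` by the identity. -/
def offExt {n : ℕ} (s : Finset (Fin n)) (h : Matrix {x // x ∈ s} {x // x ∈ s} K) :
    Matrix (Fin n) (Fin n) K :=
  (fromBlocks h 0 0 (1 : Matrix {x // ¬ x ∈ s} {x // ¬ x ∈ s} K)).submatrix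
    (Equiv.sumCompl (· ∈ s)).symm (Equiv.sumCompl (· ∈ s)).symm

variable {n : ℕ} (s : Finset (Fin n))

theorem offExt_mul (g h : Matrix {x // x ∈ s} {x // x ∈ s} K) :
    offExt s g * offExt s h = offExt s (g * h) := by
  unfold offExt
  rw [Matrix.submatrix_mul_equiv, fromBlocks_multiply]
  simp

theorem offExt_one : offExt s (1 : Matrix {x // x ∈ s} {x // x ∈ s} K) = 1 := by
  unfold offExt
  rw [fromBlocks_one, Matrix.submatrix_one_equiv]

theorem mul_offExt_mem (M : Matrix (Fin n) (Fin n) K) (h : Matrix {x // x ∈ s} {x // x ∈ s} K)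
    (i : Fin n) (l : {x // x ∈ s}) :
    (M * offExt s h) i l = ∑ l' : {x // x ∈ s}, M i l' * h l' l := by
  rw [Matrix.mul_apply, ← (Equiv.sumCompl (· ∈ s)).sum_comp, Fintype.sum_sum_type]
  simp [offExt, Equiv.sumCompl_symm_apply_of_pos, l.2]

theorem offExt_mul_mem (M : Matrix (Fin n) (Fin n) K) (h : Matrix {x // x ∈ s} {x // x ∈ s} K)
    (l : {x // x ∈ s}) (i : Fin n) :
    (offExt s h * M) l i = ∑ l' : {x // x ∈ s}, h l l' * M l' i := by
  rw [Matrix.mul_apply, ← (Equiv.sumCompl (· ∈ s)).sum_comp, Fintype.sum_sum_type]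
  simp [offExt, Equiv.sumCompl_symm_apply_of_pos, l.2]

theorem mul_offExt_notMem (M : Matrix (Fin n) (Fin n) K)
    (h : Matrix {x // x ∈ s} {x // x ∈ s} K) (i l : Fin n) (hl : l ∉ s) :
    (M * offExt s h) i l = M i l := by
  rw [Matrix.mul_apply, ← (Equiv.sumCompl (· ∈ s)).sum_comp, Fintype.sum_sum_type]
  simp [offExt, Equiv.sumCompl_symm_apply_of_neg, hl, Matrix.one_apply]

theorem offExt_mul_notMem (M : Matrix (Fin n) (Fin n) K)
    (h : Matrix {x // x ∈ s} {x // x ∈ s} K) (i l : Fin n) (hl : l ∉ s) :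
    (offExt s h * M) l i = M l i := by
  rw [Matrix.mul_apply, ← (Equiv.sumCompl (· ∈ s)).sum_comp, Fintype.sum_sum_type]
  simp [offExt, Equiv.sumCompl_symm_apply_of_neg, hl, Matrix.one_apply]

theorem off_conj_block (Ks Ls : Finset (Fin n)) (hdisj : Disjoint Ks Ls)
    (Q : Matrix (Fin n) (Fin n) K) (g : Matrix {x // x ∈ Ks} {x // x ∈ Ks} K)
    (h : Matrix {x // x ∈ Ls} {x // x ∈ Ls} K) (hg : IsUnit g.det) (hh : IsUnit h.det) :
    ∃ C : Matrix (Fin n) (Fin n) K, IsUnit C.det ∧ ∀ (k : {x // x ∈ Ks}) (l : {x // x ∈ Ls}),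
      (C⁻¹ * Q * C) k l =
        (g * Q.submatrix (Subtype.val : {x // x ∈ Ks} → Fin n)
          (Subtype.val : {x // x ∈ Ls} → Fin n) * h) k l := by
  have hC : (offExt Ks g * offExt Ls h⁻¹) * (offExt Ls h * offExt Ks g⁻¹) = 1 := by
    rw [Matrix.mul_assoc, ← Matrix.mul_assoc (offExt Ls h⁻¹), offExt_mul,
      Matrix.nonsing_inv_mul _ hh, offExt_one, Matrix.one_mul, offExt_mul,
      Matrix.mul_nonsing_inv _ hg, offExt_one]
  refine ⟨offExt Ls h * offExt Ks g⁻¹, ?_, ?_⟩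
  · exact Matrix.isUnit_det_of_left_inverse hC
  · intro k l
    rw [Matrix.inv_eq_left_inv hC]
    have e : offExt Ks g * offExt Ls h⁻¹ * Q * (offExt Ls h * offExt Ks g⁻¹) =
      (offExt Ks g * (offExt Ls h⁻¹ * (Q * offExt Ls h))) * offExt Ks g⁻¹ := by
      simp only [Matrix.mul_assoc]
    rw [e, mul_offExt_notMem _ _ _ _ _ (Finset.disjoint_right.1 hdisj l.2), offExt_mul_mem,
      Matrix.mul_assoc, Matrix.mul_apply]
    refine Finset.sum_congr rfl fun k' _ => ?_
    rw [offExt_mul_notMem _ _ _ _ _ (Finset.disjoint_left.1 hdisj k'.2), mul_offExt_mem,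
      Matrix.mul_apply]
    rfl

theorem off_exists_basis {e : ℕ} (P : Matrix (Fin n) (Fin n) K) (u : Fin e → Fin n → K)
    (hu : LinearIndependent K (Sum.elim u (fun i => P *ᵥ (u i))))
    (κ l : Fin e → Fin n) (hκl : Function.Injective (Sum.elim l κ)) :
    ∃ B : Matrix (Fin n) (Fin n) K, IsUnit B.det ∧
      ∀ i j, (B⁻¹ * P * B) i (l j) = (1 : Matrix (Fin n) (Fin n) K) i (κ j) := by
  have h1 : LinearIndependent K
      (fun x => (Pi.single (Sum.elim l κ x) (1 : K) : Fin n → K)) := by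
    have := (Pi.basisFun K (Fin n)).linearIndependent.comp _ hκl
    convert this using 1
    ext x
    simp
  let f := (Module.Basis.span h1).equiv (Module.Basis.span hu) (Equiv.refl _)
  obtain ⟨g, hg⟩ := Submodule.exists_linearEquiv_restrict_eq f
  have hg' : ∀ x, g (Pi.single (Sum.elim l κ x) (1 : K) : Fin n → K) =
      Sum.elim u (fun i => P *ᵥ (u i)) x := by
    intro x
    have h2 := hg (Module.Basis.span h1 x)
    rw [Module.Basis.equiv_apply, Module.Basis.span_apply, Module.Basis.span_apply] at h2
    exact h2.symm
  have hdet : IsUnit (LinearMap.toMatrix' (g : (Fin n → K) →ₗ[K] (Fin n → K))).det := by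
    rw [LinearMap.det_toMatrix']
    exact LinearEquiv.isUnit_det' g
  set B := LinearMap.toMatrix' (g : (Fin n → K) →ₗ[K] (Fin n → K)) with hB
  have hBv : ∀ v, B *ᵥ v = g v := fun v => by rw [hB, LinearMap.toMatrix'_mulVec]; rfl
  refine ⟨B, hdet, fun i j => ?_⟩
  have h3 : (B⁻¹ * P * B) *ᵥ Pi.single (l j) 1 = Pi.single (κ j) 1 := by
    rw [← Matrix.mulVec_mulVec, ← Matrix.mulVec_mulVec, hBv]
    have a1 := hg' (Sum.inl j)
    have a2 := hg' (Sum.inr j)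
    simp only [Sum.elim_inl, Sum.elim_inr] at a1 a2
    rw [a1, ← a2, ← hBv, Matrix.mulVec_mulVec, Matrix.nonsing_inv_mul _ hdet, Matrix.one_mulVec]
  have h4 := congrFun h3 i
  rw [Matrix.mulVec_single_one] at h4
  simpa [Matrix.one_apply, Pi.single_apply] using h4

theorem off_conj_det_one (P B : Matrix (Fin n) (Fin n) K) (hB : IsUnit B.det) (i₀ : Fin n) :
    ∃ A : Matrix (Fin n) (Fin n) K, A.det = 1 ∧ ∀ i j, i ≠ i₀ → j ≠ i₀ →
      (A * P * A⁻¹) i j = (B⁻¹ * P * B) i j := by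
  set D : Matrix (Fin n) (Fin n) K := diagonal (Function.update 1 i₀ (B.det)⁻¹) with hD
  set D' : Matrix (Fin n) (Fin n) K := diagonal (Function.update 1 i₀ (B.det)) with hD'
  have hne : B.det ≠ 0 := hB.ne_zero
  have hDD : D' * D = 1 := by
    rw [hD, hD', diagonal_mul_diagonal, ← diagonal_one]
    congr 1
    funext i
    by_cases h : i = i₀
    · subst h; simp [hne]
    · simp [h]
  have hdet : D'.det = B.det := by
    rw [hD', det_diagonal, Finset.prod_update_of_mem (Finset.mem_univ _)]
    simp
  have hinv : (D' * B⁻¹) * (B * D) = 1 := by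
    rw [Matrix.mul_assoc, ← Matrix.mul_assoc B⁻¹, Matrix.nonsing_inv_mul _ hB, Matrix.one_mul, hDD]
  refine ⟨D' * B⁻¹, ?_, fun i j hi hj => ?_⟩
  · rw [det_mul, hdet, det_nonsing_inv, Ring.mul_inverse_cancel _ hB]
  · rw [Matrix.inv_eq_right_inv hinv]
    have e : D' * B⁻¹ * P * (B * D) = D' * (B⁻¹ * P * B) * D := by simp only [Matrix.mul_assoc]
    rw [e, hD, hD', mul_diagonal, diagonal_mul]
    simp [hi, hj]

theorem off_density [Infinite K] {α β : Type*} [Fintype α] [DecidableEq α] [Fintype β]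
    [DecidableEq β] (f : MvPolynomial (α × β) K) (D : Matrix α β K)
    (h : ∀ (g : Matrix α α K) (h : Matrix β β K), IsUnit g.det → IsUnit h.det →
      MvPolynomial.eval (fun p => (g * D * h) p.1 p.2) f = 0)
    (g : Matrix α α K) (k : Matrix β β K) :
    MvPolynomial.eval (fun p => (g * D * k) p.1 p.2) f = 0 := by
  let G : Matrix α α (Polynomial K) :=
    (1 : Matrix α α K).map Polynomial.C + (Polynomial.X : Polynomial K) • (g - 1).map Polynomial.C
  let H : Matrix β β (Polynomial K) :=
    (1 : Matrix β β K).map Polynomial.C + (Polynomial.X : Polynomial K) • (k - 1).map Polynomial.C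
  let F : Polynomial K :=
    MvPolynomial.aeval (fun p : α × β => (G * D.map Polynomial.C * H) p.1 p.2) f
  have hG : ∀ t, G.map (Polynomial.evalRingHom t) = 1 + t • (g - 1) := by
    intro t; ext i j; by_cases hij : i = j <;> simp [G, hij] <;> ring
  have hH : ∀ t, H.map (Polynomial.evalRingHom t) = 1 + t • (k - 1) := by
    intro t; ext i j; by_cases hij : i = j <;> simp [H, hij] <;> ring
  have hGd : ∀ t, Polynomial.eval t G.det = (1 + t • (g - 1)).det := by
    intro t
    rw [← hG t, ← Polynomial.coe_evalRingHom, RingHom.map_det]; rfl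
  have hHd : ∀ t, Polynomial.eval t H.det = (1 + t • (k - 1)).det := by
    intro t
    rw [← hH t, ← Polynomial.coe_evalRingHom, RingHom.map_det]; rfl
  have hF : ∀ t, Polynomial.eval t F =
      MvPolynomial.eval (fun p => ((1 + t • (g - 1)) * D * (1 + t • (k - 1)) : Matrix α β K) p.1 p.2) f := by
    intro t
    have hD : (D.map Polynomial.C).map (Polynomial.evalRingHom t) = D := by
      ext i j; simp
    have : (G * D.map Polynomial.C * H).map (Polynomial.evalRingHom t) =
        (1 + t • (g - 1)) * D * (1 + t • (k - 1)) := by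
      rw [Matrix.map_mul, Matrix.map_mul, hG, hH, hD]
    rw [← this]
    simp only [F]
    rw [← Polynomial.coe_evalRingHom, MvPolynomial.aeval_def, MvPolynomial.hom_eval₂]
    have hc : (Polynomial.evalRingHom t).comp (algebraMap K (Polynomial K)) = RingHom.id K := by
      ext x; simp
    rw [hc]
    rfl
  have hz : G.det * H.det * F = 0 := by
    refine Polynomial.funext fun t => ?_
    rw [Polynomial.eval_mul, Polynomial.eval_mul, hGd, hHd, hF, Polynomial.eval_zero]
    by_cases h1 : (1 + t • (g - 1)).det = 0
    · rw [h1]; ring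
    by_cases h2 : (1 + t • (k - 1)).det = 0
    · rw [h2]; ring
    rw [h _ _ (isUnit_iff_ne_zero.2 h1) (isUnit_iff_ne_zero.2 h2), mul_zero]
  have hG0 : G.det ≠ 0 := fun h0 => by
    have := hGd 0
    simp [h0] at this
  have hH0 : H.det ≠ 0 := fun h0 => by
    have := hHd 0
    simp [h0] at this
  have hF0 : F = 0 := (mul_eq_zero.1 hz).resolve_left (mul_ne_zero hG0 hH0)
  have := hF 1
  rw [hF0, Polynomial.eval_zero] at this
  simpa using this.symm

theorem off_sparse [Infinite K] {σ : Type*} (f : MvPolynomial σ K) (hf : f ≠ 0) :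
    ∃ S : Finset σ, S.card ≤ f.totalDegree ∧ ∃ x : σ → K, (∀ p ∉ S, x p = 0) ∧
      MvPolynomial.eval x f ≠ 0 := by
  classical
  obtain ⟨s, hs⟩ := MvPolynomial.ne_zero_iff.1 hf
  refine ⟨s.support, ?_, ?_⟩
  · refine le_trans ?_ (MvPolynomial.le_totalDegree (MvPolynomial.mem_support_iff.2 hs))
    rw [Finset.card_eq_sum_ones, Finsupp.sum]
    exact Finset.sum_le_sum fun i hi => Nat.one_le_iff_ne_zero.2 (Finsupp.mem_support_iff.1 hi)
  · let f' : MvPolynomial σ K :=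
      MvPolynomial.aeval (fun p => if p ∈ s.support then (MvPolynomial.X p : MvPolynomial σ K) else 0) f
    have hmon : ∀ t : σ →₀ ℕ, ∀ c : K,
        MvPolynomial.coeff s (MvPolynomial.aeval
          (fun p => if p ∈ s.support then (MvPolynomial.X p : MvPolynomial σ K) else 0)
          (MvPolynomial.monomial t c)) = MvPolynomial.coeff s (MvPolynomial.monomial t c) := by
      intro t c
      by_cases ht : t.support ⊆ s.support
      · rw [MvPolynomial.aeval_monomial, MvPolynomial.monomial_eq]
        congr 2
        refine Finset.prod_congr rfl fun i hi => ?_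
        simp only [if_pos (ht hi)]
      · obtain ⟨i, hi, his⟩ := Finset.not_subset.1 ht
        rw [MvPolynomial.aeval_monomial, Finsupp.prod, Finset.prod_eq_zero hi, mul_zero,
          MvPolynomial.coeff_monomial, if_neg, MvPolynomial.coeff_zero]
        · rintro rfl; exact his hi
        · simp only [if_neg his]; exact zero_pow (Finsupp.mem_support_iff.1 hi)
    have hall : ∀ p : MvPolynomial σ K, MvPolynomial.coeff s (MvPolynomial.aeval
          (fun p => if p ∈ s.support then (MvPolynomial.X p : MvPolynomial σ K) else 0) p) =
          MvPolynomial.coeff s p := by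
      intro p
      induction p using MvPolynomial.induction_on' with
      | monomial t c => exact hmon t c
      | add p q hp hq => rw [map_add, MvPolynomial.coeff_add, MvPolynomial.coeff_add, hp, hq]
    have hf' : f' ≠ 0 := fun h0 => hs (by rw [← hall f]; change MvPolynomial.coeff s f' = 0; simp [h0])
    obtain ⟨x, hx⟩ : ∃ x, MvPolynomial.eval x f' ≠ 0 := by
      by_contra hcon
      push Not at hcon
      exact hf' (MvPolynomial.funext fun x => by simpa using hcon x)
    refine ⟨fun p => if p ∈ s.support then x p else 0, fun p hp => if_neg hp, ?_⟩
    convert hx using 1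
    simp only [f']
    rw [MvPolynomial.aeval_def, MvPolynomial.hom_eval₂]
    have hc : (MvPolynomial.eval x).comp (algebraMap K (MvPolynomial σ K)) = RingHom.id K := by
      ext y; simp
    rw [hc, MvPolynomial.eval₂_id]
    congr 2
    funext p
    split_ifs <;> simp

end MatPart

/-- If the ideal of an `SL_n`-stable Zariski-closed subset `Y ⊆ gl_n` contains a non-zero
"off-diagonal" polynomial `f` (depending only on the entries `p_{kℓ}` with `k ∈ 𝒦`,
`ℓ ∈ 𝒧` for disjoint `𝒦, 𝒧` of size `m ≤ (n-1)/2`), then `rk(P, I_n) < deg f` for all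
`P ∈ Y`. -/
theorem pairRank_lt_of_offdiagonal_poly {K : Type*} [Field K] [Infinite K]
    (n m : ℕ) (hm : 2 * m + 1 ≤ n)
    (Y : Set (Matrix (Fin n) (Fin n) K)) (hclosed : MZClosed Y)
    (hstable : ∀ A : Matrix (Fin n) (Fin n) K, A.det = 1 → ∀ P ∈ Y, A * P * A⁻¹ ∈ Y)
    (Ks Ls : Finset (Fin n)) (hdisj : Disjoint Ks Ls)
    (hK : Ks.card = m) (hL : Ls.card = m)
    (f : MvPolynomial ({x // x ∈ Ks} × {x // x ∈ Ls}) K) (hf : f ≠ 0)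
    (hvan : ∀ P ∈ Y, MvPolynomial.eval (fun p => P (p.1 : Fin n) (p.2 : Fin n)) f = 0) :
    ∀ P ∈ Y, pairRank P 1 < (f.totalDegree : ℕ∞) := by
  classical
  intro P hP
  by_contra hcon
  rw [not_lt] at hcon
  set d := f.totalDegree with hd
  set e := min d m with he
  have hrank : ∀ c : K, d ≤ Module.finrank K
      (LinearMap.range (P.mulVecLin - c • LinearMap.id)) := by
    intro c
    have h1 : (d : ℕ∞) ≤ (((1 : K) • P + (-c) • (1 : Matrix (Fin n) (Fin n) K)).rank : ℕ∞) :=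
      hcon.trans (iInf_le (fun μ : {μ : K × K // μ ≠ 0} =>
        ((μ.1.1 • P + μ.1.2 • (1 : Matrix (Fin n) (Fin n) K)).rank : ℕ∞)) ⟨(1, -c), by simp⟩)
    have h2 : d ≤ ((1 : K) • P + (-c) • (1 : Matrix (Fin n) (Fin n) K)).rank := by
      exact_mod_cast h1
    have h3 : P.mulVecLin - c • LinearMap.id =
        ((1 : K) • P + (-c) • (1 : Matrix (Fin n) (Fin n) K)).mulVecLin := by
      refine LinearMap.ext fun v => ?_
      simp [sub_eq_add_neg]
    rw [h3]
    exact h2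
  have hem : e ≤ m := min_le_right _ _
  have hed : e ≤ d := min_le_left _ _
  obtain ⟨u, hu⟩ := off_exists_adm P.mulVecLin e (by simp; omega)
    (fun c => hed.trans (hrank c)) e le_rfl
  obtain ⟨κ⟩ := Function.Embedding.nonempty_of_card_le (α := Fin e) (β := {x // x ∈ Ks})
    (by simp; omega)
  obtain ⟨l⟩ := Function.Embedding.nonempty_of_card_le (α := Fin e) (β := {x // x ∈ Ls})
    (by simp; omega)
  have hinj : Function.Injective
      (Sum.elim (fun i => (l i : Fin n)) (fun i => (κ i : Fin n))) := by
    refine Function.Injective.sumElim (Subtype.val_injective.comp l.injective)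
      (Subtype.val_injective.comp κ.injective) fun i j h => ?_
    exact Finset.disjoint_left.1 hdisj (κ j).2 (h ▸ (l i).2)
  obtain ⟨B, hB, hBe⟩ := off_exists_basis P u hu.linInd _ _ hinj
  obtain ⟨i₀, hi₀⟩ : ∃ i₀, i₀ ∉ Ks ∪ Ls := by
    by_contra h
    push Not at h
    have h1 : (Ks ∪ Ls) = Finset.univ := Finset.eq_univ_of_forall h
    have h2 := Finset.card_union_le Ks Ls
    rw [h1, Finset.card_univ, Fintype.card_fin] at h2
    omega
  rw [Finset.mem_union, not_or] at hi₀
  have hgood : ∀ B : Matrix (Fin n) (Fin n) K, IsUnit B.det →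
      MvPolynomial.eval (fun p : {x // x ∈ Ks} × {x // x ∈ Ls} =>
        (B⁻¹ * P * B) (p.1 : Fin n) (p.2 : Fin n)) f = 0 := by
    intro B hB
    obtain ⟨A, hA, hAe⟩ := off_conj_det_one P B hB i₀
    rw [← hvan _ (hstable A hA P hP)]
    congr 2
    funext p
    refine (hAe _ _ ?_ ?_).symm
    · intro h; exact hi₀.1 (h ▸ p.1.2)
    · intro h; exact hi₀.2 (h ▸ p.2.2)
  set Q := B⁻¹ * P * B with hQ
  set D := Q.submatrix (Subtype.val : {x // x ∈ Ks} → Fin n)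
    (Subtype.val : {x // x ∈ Ls} → Fin n) with hD
  have hdens := off_density f D (by
    intro g h hg hh
    obtain ⟨C, hC, hCe⟩ := off_conj_block Ks Ls hdisj Q g h hg hh
    have h1 := hgood (B * C) (by rw [Matrix.det_mul]; exact hB.mul hC)
    rw [← h1]
    congr 2
    funext p
    rw [← hCe, Matrix.mul_inv_rev, hQ]
    simp only [Matrix.mul_assoc])
  have hDs : D.submatrix κ l = 1 := by
    ext i j
    simp only [hD, Matrix.submatrix_apply]
    rw [hBe]
    simp [Matrix.one_apply, Subtype.val_injective.eq_iff, κ.injective.eq_iff]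
  have hlow : ∀ (X : Matrix {x // x ∈ Ks} (Fin e) K) (Y : Matrix (Fin e) {x // x ∈ Ls} K),
      MvPolynomial.eval (fun p => (X * Y) p.1 p.2) f = 0 := by
    intro X Y
    have h1 := hdens (X * (1 : Matrix {x // x ∈ Ks} {x // x ∈ Ks} K).submatrix κ id)
      ((1 : Matrix {x // x ∈ Ls} {x // x ∈ Ls} K).submatrix id l * Y)
    have h2 : (1 : Matrix {x // x ∈ Ks} {x // x ∈ Ks} K).submatrix κ id * D *
        (1 : Matrix {x // x ∈ Ls} {x // x ∈ Ls} K).submatrix id l = 1 := by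
      rw [← hDs]
      ext i j
      simp [Matrix.mul_apply, Matrix.one_apply]
    have h3 : X * (1 : Matrix {x // x ∈ Ks} {x // x ∈ Ks} K).submatrix κ id * D *
        ((1 : Matrix {x // x ∈ Ls} {x // x ∈ Ls} K).submatrix id l * Y) = X * Y := by
      have : X * (1 : Matrix {x // x ∈ Ks} {x // x ∈ Ks} K).submatrix κ id * D *
        ((1 : Matrix {x // x ∈ Ls} {x // x ∈ Ls} K).submatrix id l * Y) =
        X * ((1 : Matrix {x // x ∈ Ks} {x // x ∈ Ks} K).submatrix κ id * D *
        (1 : Matrix {x // x ∈ Ls} {x // x ∈ Ls} K).submatrix id l) * Y := by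
        simp only [Matrix.mul_assoc]
      rw [this, h2, Matrix.mul_one]
    rw [h3] at h1
    exact h1
  obtain ⟨S, hS, x, hx0, hx⟩ := off_sparse f hf
  apply hx
  obtain ⟨X, Y, hXY⟩ : ∃ (X : Matrix {x // x ∈ Ks} (Fin e) K) (Y : Matrix (Fin e) {x // x ∈ Ls} K),
      (Matrix.of fun k l => x (k, l)) = X * Y := by
    rcases le_total d m with hdm | hdm
    · have hed' : e = d := min_eq_left hdm
      obtain ⟨X, Y, h⟩ := off_factor_fin (ι := {p // p ∈ S}) (e := e) (by simp; omega)
        (Matrix.of fun (k : {x // x ∈ Ks}) (p : {p // p ∈ S}) => if p.1.1 = k then x p.1 else 0)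
        (Matrix.of fun (p : {p // p ∈ S}) (l : {x // x ∈ Ls}) => if p.1.2 = l then (1 : K) else 0)
      refine ⟨X, Y, ?_⟩
      rw [← h]
      ext k l
      simp only [Matrix.of_apply, Matrix.mul_apply]
      by_cases hkl : (k, l) ∈ S
      · rw [Finset.sum_eq_single ⟨(k, l), hkl⟩]
        · simp
        · rintro ⟨⟨a, b⟩, hab⟩ _ hne
          by_cases h1 : a = k
          · by_cases h2 : b = l
            · subst h1; subst h2; exact absurd rfl hne
            · simp [h2]
          · simp [h1]
        · simp
      · rw [hx0 _ hkl, Finset.sum_eq_zero]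
        rintro ⟨⟨a, b⟩, hab⟩ _
        by_cases h1 : a = k
        · by_cases h2 : b = l
          · subst h1; subst h2; exact absurd hab hkl
          · simp [h2]
        · simp [h1]
    · have hem' : e = m := min_eq_right hdm
      obtain ⟨X, Y, h⟩ := off_factor_fin (ι := {x // x ∈ Ls}) (e := e) (by simp; omega)
        (Matrix.of fun (k : {x // x ∈ Ks}) (l : {x // x ∈ Ls}) => x (k, l))
        (1 : Matrix {x // x ∈ Ls} {x // x ∈ Ls} K)
      exact ⟨X, Y, by rw [← h, Matrix.mul_one]⟩
  have := hlow X Y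
  rw [← hXY] at this
  exact this
end
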